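/- arXiv:2009.12080 — 12 statements merged into one kernel-verified Lean document; each statement's English description precedes it below -/
import Mathlib

section
/- Let P ⊆ ℝⁿ be a bounded full-dimensional polytope with 0 in the interior of P, assume μ(P) ≤ μ₀ for some μ₀ > 0, and set L_P := ℤⁿ ∩ ([0,1]ⁿ − μ₀·P). Then for every μ > 0 one has: μ > μ(P) if and only if [0,1]ⁿ ⊆ int(μ·P) + L_P. -/
open Pointwise

/-- The covering radius of a set `K ⊆ ℝⁿ` with respect to the lattice `ℤⁿ`:
the least `μ ≥ 0` such that the lattice translates of `μ • K` cover `ℝⁿ`. -/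
noncomputable def covRad {n : ℕ} (K : Set (Fin n → ℝ)) : ℝ :=
  sInf {μ : ℝ | 0 ≤ μ ∧ ∀ x : Fin n → ℝ, ∃ z : Fin n → ℤ,
    x - (fun i => (z i : ℝ)) ∈ μ • K}

/-- The real vector with integer coordinates `z`. -/
def intVec {n : ℕ} (z : Fin n → ℤ) : Fin n → ℝ := fun i => (z i : ℝ)

@[simp]
theorem intVec_zero {n : ℕ} : intVec (0 : Fin n → ℤ) = 0 := by
  ext
  simp [intVec]

section Gauge

variable {E : Type*} [NormedAddCommGroup E] [NormedSpace ℝ E] {K : Set E}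

theorem mem_smul_iff_gauge_le (hconv : Convex ℝ K) (hcl : IsClosed K)
    (hbdd : Bornology.IsBounded K) (h0 : K ∈ nhds (0 : E)) {r : ℝ} (hr : 0 ≤ r) (y : E) :
    y ∈ r • K ↔ gauge K y ≤ r := by
  rcases hr.eq_or_lt with rfl | hr
  · rw [Set.zero_smul_set ⟨0, mem_of_mem_nhds h0⟩, Set.mem_zero,
      ← gauge_eq_zero (absorbent_nhds_zero h0)
        ((NormedSpace.isVonNBounded_iff ℝ).2 hbdd)]
    exact ⟨fun h => h.le, fun h => h.antisymm (gauge_nonneg y)⟩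
  · rw [Set.mem_smul_set_iff_inv_smul_mem₀ hr.ne', ← hcl.closure_eq,
      ← gauge_le_one_iff_mem_closure hconv h0, hcl.closure_eq,
      gauge_smul_of_nonneg (inv_nonneg.2 hr.le), smul_eq_mul, inv_mul_le_one₀ hr]

theorem mem_interior_smul_iff_gauge_lt (hconv : Convex ℝ K) (h0 : K ∈ nhds (0 : E))
    {r : ℝ} (hr : 0 < r) (y : E) :
    y ∈ interior (r • K) ↔ gauge K y < r := by
  rw [interior_smul₀ hr.ne', Set.mem_smul_set_iff_inv_smul_mem₀ hr.ne',
    ← gauge_lt_one_iff_mem_interior hconv h0,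
    gauge_smul_of_nonneg (inv_nonneg.2 hr.le), smul_eq_mul, inv_mul_lt_one₀ hr]

end Gauge

section CoveringRadius

variable {n : ℕ} {K : Set (Fin n → ℝ)}

theorem finite_setOf_sub_intVec_mem {B : Set (Fin n → ℝ)} (hB : Bornology.IsBounded B)
    (x : Fin n → ℝ) : {z : Fin n → ℤ | x - intVec z ∈ B}.Finite := by
  obtain ⟨R, hR⟩ := hB.exists_norm_le
  refine (Set.finite_Icc (fun i => ⌊x i - R⌋) (fun i => ⌈x i + R⌉)).subset fun z hz => ?_
  have hz' : ∀ i, |x i - z i| ≤ R := fun i => (norm_le_pi_norm _ i).trans (hR _ hz)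
  refine ⟨fun i => ?_, fun i => ?_⟩ <;> have := abs_le.1 (hz' i)
  · exact Int.cast_le.1 ((Int.floor_le _).trans (by linarith) : ((⌊x i - R⌋ : ℤ) : ℝ) ≤ z i)
  · exact Int.cast_le.1 ((by linarith : (z i : ℝ) ≤ x i + R).trans (Int.le_ceil _))

/-- A covering condition on the unit cube propagates to the whole space. -/
theorem forall_exists_intVec_of_unitCube {p : (Fin n → ℝ) → Prop}
    (h : ∀ x ∈ Set.Icc (0 : Fin n → ℝ) 1, ∃ z : Fin n → ℤ, p (x - intVec z))
    (x : Fin n → ℝ) : ∃ z : Fin n → ℤ, p (x - intVec z) := by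
  obtain ⟨z, hz⟩ := h (fun i => Int.fract (x i))
    ⟨fun i => Int.fract_nonneg _, fun i => (Int.fract_lt_one _).le⟩
  refine ⟨fun i => ⌊x i⌋ + z i, ?_⟩
  convert hz using 1
  ext i
  simp only [Pi.sub_apply, intVec, Int.cast_add, Int.fract]
  ring

/-- The infimum defining the covering radius is attained. -/
theorem exists_sub_intVec_gauge_le_covRad (hconv : Convex ℝ K) (hcl : IsClosed K)
    (hbdd : Bornology.IsBounded K) (h0 : K ∈ nhds (0 : Fin n → ℝ)) (x : Fin n → ℝ) :
    ∃ z : Fin n → ℤ, gauge K (x - intVec z) ≤ covRad K := by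
  have hmem {r : ℝ} (hr : 0 ≤ r) := mem_smul_iff_gauge_le hconv hcl hbdd h0 hr
  obtain ⟨z, -, hz⟩ : ∃ z ∈ {z : Fin n → ℤ | gauge K (x - intVec z) ≤ gauge K x},
      ∀ w ∈ {z : Fin n → ℤ | gauge K (x - intVec z) ≤ gauge K x},
        gauge K (x - intVec z) ≤ gauge K (x - intVec w) := by
    refine Set.exists_min_image _ _ ?_ ⟨0, ?_⟩
    · simp_rw [← hmem (gauge_nonneg x)]
      exact finite_setOf_sub_intVec_mem (hbdd.smul₀ _) x
    · simp
  have hz0 : gauge K (x - intVec z) ≤ gauge K x := by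
    simpa using hz 0 (by simp)
  refine ⟨z, le_csInf ?_ ?_⟩
  · obtain ⟨C, hC⟩ := (isCompact_Icc (a := (0 : Fin n → ℝ)) (b := 1)).bddAbove_image
      (continuous_gauge hconv h0).continuousOn
    refine ⟨max C 0, le_max_right _ _, forall_exists_intVec_of_unitCube fun y hy => ⟨0, ?_⟩⟩
    rw [hmem (le_max_right _ _), intVec_zero, sub_zero]
    exact (hC (Set.mem_image_of_mem _ hy)).trans (le_max_left _ _)
  · rintro r ⟨hr, hcov⟩
    obtain ⟨w, hw⟩ := hcov x
    have hw : gauge K (x - intVec w) ≤ r := (hmem hr _).1 hw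
    rcases le_total (gauge K (x - intVec w)) (gauge K x) with h | h
    · exact (hz w h).trans hw
    · exact hz0.trans (h.trans hw)

/-- If the open translates of radius `r` cover the unit cube, then `r` exceeds the
covering radius. -/
theorem covRad_lt_of_unitCube (hconv : Convex ℝ K) (hcl : IsClosed K)
    (hbdd : Bornology.IsBounded K) (h0 : K ∈ nhds (0 : Fin n → ℝ)) {r : ℝ} (hr : 0 < r)
    (h : ∀ x ∈ Set.Icc (0 : Fin n → ℝ) 1, ∃ z : Fin n → ℤ, gauge K (x - intVec z) < r) :
    covRad K < r := by
  let U : Set.Iio r → Set (Fin n → ℝ) := fun q => ⋃ z : Fin n → ℤ,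
    {x | gauge K (x - intVec z) < q}
  have : Nonempty (Set.Iio r) := ⟨⟨0, hr⟩⟩
  have hU : Monotone U := fun p q hpq =>
    Set.iUnion_mono fun z x hx => lt_of_lt_of_le hx (Subtype.coe_le_coe.2 hpq)
  obtain ⟨⟨q, hq⟩, hqU⟩ := (isCompact_Icc (a := (0 : Fin n → ℝ)) (b := 1)).elim_directed_cover U
    (fun q => isOpen_iUnion fun z => isOpen_lt
      ((continuous_gauge hconv h0).comp (continuous_id.sub continuous_const)) continuous_const)
    (fun x hx => by
      obtain ⟨z, hz⟩ := h x hx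
      obtain ⟨q, hq₁, hq₂⟩ := exists_between hz
      exact Set.mem_iUnion.2 ⟨⟨q, hq₂⟩, Set.mem_iUnion.2 ⟨z, hq₁⟩⟩)
    hU.directed_le
  refine lt_of_le_of_lt (csInf_le ⟨0, fun _ hs => hs.1⟩ ?_) (max_lt hq hr)
  refine ⟨le_max_right _ _, forall_exists_intVec_of_unitCube fun x hx => ?_⟩
  obtain ⟨z, hz⟩ := Set.mem_iUnion.1 (hqU hx)
  exact ⟨z, (mem_smul_iff_gauge_le hconv hcl hbdd h0 (le_max_right _ _) _).2
    ((le_of_lt hz).trans (le_max_left _ _))⟩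

end CoveringRadius

theorem polyhedron_eq_iInter {n m : ℕ} (a : Fin m → Fin n → ℝ) (b : Fin m → ℝ) :
    {x : Fin n → ℝ | ∀ i, ∑ j, a i j * x j ≤ b i} =
      ⋂ i, {x | dotProduct (a i) x ≤ b i} := by
  ext
  simp [dotProduct]

theorem convex_polyhedron {n m : ℕ} (a : Fin m → Fin n → ℝ) (b : Fin m → ℝ) :
    Convex ℝ {x : Fin n → ℝ | ∀ i, ∑ j, a i j * x j ≤ b i} := by
  rw [polyhedron_eq_iInter]
  exact convex_iInter fun i => convex_halfSpace_le
    ⟨dotProduct_add (a i), fun c x => dotProduct_smul c (a i) x⟩ _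

theorem isClosed_polyhedron {n m : ℕ} (a : Fin m → Fin n → ℝ) (b : Fin m → ℝ) :
    IsClosed {x : Fin n → ℝ | ∀ i, ∑ j, a i j * x j ≤ b i} := by
  simp only [Set.ofPred_forall]
  exact isClosed_iInter fun i => isClosed_le (by fun_prop) continuous_const

theorem stmt2 (n m : ℕ) (a : Fin m → Fin n → ℝ) (b : Fin m → ℝ)
    (P : Set (Fin n → ℝ))
    (hP : P = {x : Fin n → ℝ | ∀ i, ∑ j, a i j * x j ≤ b i})
    (hbdd : Bornology.IsBounded P)
    (h0 : (0 : Fin n → ℝ) ∈ interior P)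
    (μ₀ : ℝ) (hμ₀pos : 0 < μ₀) (hμ₀ : covRad P ≤ μ₀) :
    ∀ μ : ℝ, 0 < μ →
      (covRad P < μ ↔
        Set.Icc (0 : Fin n → ℝ) 1 ⊆
          interior (μ • P) +
            {z : Fin n → ℝ | (∀ i, ∃ k : ℤ, z i = (k : ℝ)) ∧
              z ∈ Set.Icc (0 : Fin n → ℝ) 1 - μ₀ • P}) := by
  intro μ hμ
  have hconv : Convex ℝ P := hP ▸ convex_polyhedron a b
  have hcl : IsClosed P := hP ▸ isClosed_polyhedron a b
  have hnhds : P ∈ nhds (0 : Fin n → ℝ) := mem_interior_iff_mem_nhds.1 h0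
  constructor
  · intro hlt x hx
    obtain ⟨z, hz⟩ := exists_sub_intVec_gauge_le_covRad hconv hcl hbdd hnhds x
    refine Set.mem_add.2 ⟨x - intVec z,
      (mem_interior_smul_iff_gauge_lt hconv hnhds hμ _).2 (hz.trans_lt hlt),
      intVec z, ⟨fun i => ⟨z i, rfl⟩, ?_⟩, sub_add_cancel _ _⟩
    exact Set.mem_sub.2 ⟨x, hx, x - intVec z,
      (mem_smul_iff_gauge_le hconv hcl hbdd hnhds hμ₀pos.le _).2 (hz.trans hμ₀),
      sub_sub_cancel _ _⟩
  · intro hcov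
    refine covRad_lt_of_unitCube hconv hcl hbdd hnhds hμ fun x hx => ?_
    obtain ⟨y, hy, w, ⟨hw, -⟩, rfl⟩ := Set.mem_add.1 (hcov hx)
    choose z hz using hw
    obtain rfl : w = intVec z := funext hz
    exact ⟨z, by simpa using (mem_interior_smul_iff_gauge_lt hconv hnhds hμ y).1 hy⟩
end

section
/- Let v₁, v₂, v₃ be pairwise distinct positive integers with gcd(v₁, v₂, v₃) = 1 such that (v₁, v₂, v₃) is not a permutation of (1, 2, 3). Then there exists ε > 0 such that for all starting points s₁, s₂, s₃ ∈ ℝ there is a real number t with the distance of s_j + t·v_j to the nearest integer at least 1/4 + ε for each j ∈ {1,2,3}. (In other words, up to scaling and permuting coordinates, (1,2,3) is the only extremal velocity vector for the shifted Lonely Runner problem with three moving runners.) -/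
/-- The real number `x` has distance at least `1 / 4 + ε` to the nearest integer. -/
def FarFromInt (ε x : ℝ) : Prop :=
  ∃ m : ℤ, (m : ℝ) + 1 / 4 + ε ≤ x ∧ x ≤ m + 3 / 4 - ε

theorem FarFromInt.le_abs_sub {ε x : ℝ} (h : FarFromInt ε x) (k : ℤ) :
    1 / 4 + ε ≤ |x - k| := by
  obtain ⟨m, h1, h2⟩ := h
  rcases le_or_gt k m with hk | hk
  · have : (k : ℝ) ≤ m := by exact_mod_cast hk
    exact le_trans (by linarith) (le_abs_self _)
  · have : (m : ℝ) + 1 ≤ k := by exact_mod_cast hk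
    exact le_trans (by linarith) (neg_le_abs _)

theorem FarFromInt.add_int {ε x : ℝ} (h : FarFromInt ε x) (k : ℤ) : FarFromInt ε (x + k) := by
  obtain ⟨m, h1, h2⟩ := h
  exact ⟨m + k, by push_cast; linarith, by push_cast; linarith⟩

theorem exists_pos_mul_le_mul_le {a b c d : ℝ} (ha : 0 < a) (hb : 0 < b) (hc : 0 < c)
    (hd : 0 < d) : ∃ ε : ℝ, 0 < ε ∧ ε * a ≤ c ∧ ε * b ≤ d := by
  refine ⟨min (c / a) (d / b), lt_min (by positivity) (by positivity), ?_, ?_⟩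
  · rw [← le_div_iff₀ ha]
    exact min_le_left _ _
  · rw [← le_div_iff₀ hb]
    exact min_le_right _ _

/-- A runner is far from the integers at some time in every long enough time interval. -/
theorem exists_farFromInt_of_long {ε v l : ℝ} (hv : 0 < v) (h : 1 / 2 + 2 * ε ≤ v * l)
    (hl : 0 ≤ l) (hε : ε ≤ 1 / 4) (s a : ℝ) :
    ∃ t, a ≤ t ∧ t ≤ a + l ∧ FarFromInt ε (s + t * v) := by
  set x := s + a * v with hx
  set m := ⌈x - 3 / 4 + ε⌉
  have h1 : x - 3 / 4 + ε ≤ m := Int.le_ceil _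
  have h2 : (m : ℝ) < x - 3 / 4 + ε + 1 := Int.ceil_lt_add_one _
  by_cases h3 : (m : ℝ) + 1 / 4 + ε ≤ x
  · exact ⟨a, le_rfl, by linarith, m, h3, by linarith⟩
  · push Not at h3
    have h4 : s + (a + (m + 1 / 4 + ε - x) / v) * v = m + 1 / 4 + ε := by
      rw [hx]
      field_simp
      ring
    refine ⟨a + (m + 1 / 4 + ε - x) / v, ?_, ?_, m, ?_, ?_⟩
    · have : 0 ≤ (m + 1 / 4 + ε - x) / v := div_nonneg (by linarith) hv.le
      linarith
    · have : (m + 1 / 4 + ε - x) / v ≤ l := by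
        rw [div_le_iff₀ hv]
        linarith
      linarith
    · rw [h4]
    · rw [h4]
      linarith

/-- Two runners with coprime velocities are simultaneously far from the integers during
some time interval of controlled length. -/
theorem exists_interval_farFromInt {p q : ℤ} (hp : 0 < p) (hpq : p < q) (hco : IsCoprime p q)
    {ε l : ℝ} (hl : 0 ≤ l) (h1 : q * l ≤ 1 / 2 - 2 * ε)
    (h2 : p * q * l ≤ (1 / 4 - ε) * (p + q) - 1 / 2) (s₁ s₂ : ℝ) :
    ∃ a : ℝ, ∀ t, a ≤ t → t ≤ a + l →
      FarFromInt ε (s₁ + t * p) ∧ FarFromInt ε (s₂ + t * q) := by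
  have hP : (0 : ℝ) < p := by exact_mod_cast hp
  have hPQ : (p : ℝ) < q := by exact_mod_cast hpq
  have hQ : (0 : ℝ) < q := hP.trans hPQ
  obtain ⟨x, y, hxy⟩ := hco
  set X : ℝ := q * (1 / 2 - s₁) - p * (1 / 2 - s₂)
  set n := round X
  have hn : |X - n| ≤ 1 / 2 := abs_sub_round X
  obtain ⟨hn1, hn2⟩ := abs_le.mp hn
  have hxy' : (x : ℝ) * p + y * q = 1 := by exact_mod_cast hxy
  set c : ℝ := (1 / 2 - s₁ + (-(n * y) : ℤ)) / p with hc
  set e : ℝ := (1 / 2 - s₂ + (n * x : ℤ)) / q with he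
  have hcp : c * p = 1 / 2 - s₁ + (-(n * y) : ℤ) := by rw [hc]; field_simp
  have heq : e * q = 1 / 2 - s₂ + (n * x : ℤ) := by rw [he]; field_simp
  have hce : p * q * (c - e) = X - n := by
    have : p * q * (c - e) = q * (c * p) - p * (e * q) := by ring
    rw [this, hcp, heq]
    push_cast
    linear_combination (-(n : ℝ)) * hxy'
  set g : ℝ := (1 / 4 - ε) / p with hg
  set h : ℝ := (1 / 4 - ε) / q with hh
  have hgp : g * p = 1 / 4 - ε := by rw [hg]; field_simp
  have hhq : h * q = 1 / 4 - ε := by rw [hh]; field_simp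
  have hε : 0 ≤ 1 / 4 - ε := by nlinarith [mul_nonneg hQ.le hl]
  have hlh : l ≤ 2 * h := by
    refine le_of_mul_le_mul_left ?_ hQ
    linarith
  have hhg : h ≤ g := div_le_div_of_nonneg_left hε hP hPQ.le
  have hsum : p * q * (g + h) = (1 / 4 - ε) * (p + q) := by
    linear_combination (q : ℝ) * hgp + (p : ℝ) * hhq
  have hPQ0 : (0 : ℝ) < p * q := mul_pos hP hQ
  have h3 : l ≤ g + h - (c - e) := by
    refine le_of_mul_le_mul_left ?_ hPQ0
    linarith
  have h4 : l ≤ g + h + (c - e) := by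
    refine le_of_mul_le_mul_left ?_ hPQ0
    linarith
  refine ⟨max (c - g) (e - h), fun t ht1 ht2 => ?_⟩
  have ht3 : c - g ≤ t := le_trans (le_max_left _ _) ht1
  have ht4 : e - h ≤ t := le_trans (le_max_right _ _) ht1
  have ht5 : t ≤ c + g := by
    rcases max_choice (c - g) (e - h) with hm | hm <;> rw [hm] at ht2 <;> linarith
  have ht6 : t ≤ e + h := by
    rcases max_choice (c - g) (e - h) with hm | hm <;> rw [hm] at ht2 <;> linarith
  refine ⟨⟨-(n * y), ?_, ?_⟩, ⟨n * x, ?_, ?_⟩⟩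
  · linarith [mul_le_mul_of_nonneg_right ht3 hP.le]
  · linarith [mul_le_mul_of_nonneg_right ht5 hP.le]
  · linarith [mul_le_mul_of_nonneg_right ht4 hQ.le]
  · linarith [mul_le_mul_of_nonneg_right ht6 hQ.le]

theorem exists_farFromInt_of_coprime {p q r : ℤ} (hp : 0 < p) (hpq : p < q) (hqr : q < r)
    (hco : IsCoprime p q) (h : 2 * (p * q) < r * (p + q - 2)) :
    ∃ ε : ℝ, 0 < ε ∧ ∀ s₁ s₂ s₃ : ℝ, ∃ t : ℝ, FarFromInt ε (s₁ + t * p) ∧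
      FarFromInt ε (s₂ + t * q) ∧ FarFromInt ε (s₃ + t * r) := by
  have hP : (0 : ℝ) < p := by exact_mod_cast hp
  have hPQ : (p : ℝ) < q := by exact_mod_cast hpq
  have hQ : (0 : ℝ) < q := hP.trans hPQ
  have hQR : (q : ℝ) < r := by exact_mod_cast hqr
  have hR : (0 : ℝ) < r := hQ.trans hQR
  have h' : (2 : ℝ) * (p * q) < r * (p + q - 2) := by exact_mod_cast h
  obtain ⟨ε, hε, hε1, hε2⟩ := exists_pos_mul_le_mul_le (a := 2 * q + 2 * r)
    (b := 2 * p * q + r * (p + q)) (c := (r - q) / 2)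
    (d := (r * (p + q - 2) - 2 * (p * q)) / 4)
    (by positivity) (by positivity) (by linarith) (by linarith)
  refine ⟨ε, hε, fun s₁ s₂ s₃ => ?_⟩
  set l : ℝ := (1 / 2 + 2 * ε) / r with hl
  have hlr : r * l = 1 / 2 + 2 * ε := by rw [hl]; field_simp
  have hl0 : 0 ≤ l := by positivity
  have hlq : q * l ≤ 1 / 2 - 2 * ε := by
    refine le_of_mul_le_mul_left ?_ hR
    rw [show (r : ℝ) * (q * l) = q * (r * l) by ring, hlr]
    linarith
  have hlpq : p * q * l ≤ (1 / 4 - ε) * (p + q) - 1 / 2 := by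
    refine le_of_mul_le_mul_left ?_ hR
    rw [show (r : ℝ) * (p * q * l) = p * q * (r * l) by ring, hlr]
    linarith
  obtain ⟨a, ha⟩ := exists_interval_farFromInt hp hpq hco hl0 hlq hlpq s₁ s₂
  obtain ⟨t, ht1, ht2, ht⟩ := exists_farFromInt_of_long hR hlr.ge hl0
    (by nlinarith [mul_nonneg hQ.le hl0]) s₃ a
  exact ⟨t, (ha t ht1 ht2).1, (ha t ht1 ht2).2, ht⟩

/-- If two of the velocities have a common factor `d ≥ 2`, time shifts by multiples of `1 / d`
fix these two runners while moving the third one freely. -/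
theorem exists_farFromInt_of_common_factor {p q r d : ℤ} (hp : 0 < p) (hpq : p < q) (hr : 0 < r)
    (hco : IsCoprime p q) (hd : 2 ≤ d) (hdr : IsCoprime d r) :
    ∃ ε : ℝ, 0 < ε ∧ ∀ s₁ s₂ s₃ : ℝ, ∃ t : ℝ, FarFromInt ε (s₁ + t * (d * p : ℤ)) ∧
      FarFromInt ε (s₂ + t * (d * q : ℤ)) ∧ FarFromInt ε (s₃ + t * r) := by
  have hP : (1 : ℝ) ≤ p := by exact_mod_cast hp
  have hPQ : (p : ℝ) + 1 ≤ q := by exact_mod_cast hpq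
  have hP0 : (0 : ℝ) < p := by linarith
  have hQ : (0 : ℝ) < q := by linarith
  have hR : (0 : ℝ) < r := by exact_mod_cast hr
  have hD2 : (2 : ℝ) ≤ d := by exact_mod_cast hd
  have hD : (0 : ℝ) < d := by linarith
  obtain ⟨ε, hε, hε1, hε2⟩ := exists_pos_mul_le_mul_le (a := 2 * q * d + 2 * r)
    (b := 2 * d * p * q + r * (p + q)) (c := (r : ℝ) / 2)
    (d := r * (p + q - 2) / 4)
    (by positivity) (by positivity) (by linarith)
    (div_pos (mul_pos hR (by linarith)) (by norm_num))
  refine ⟨ε, hε, fun s₁ s₂ s₃ => ?_⟩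
  set l : ℝ := 2 * ε * d / r with hl
  have hlr : r * l = 2 * ε * d := by rw [hl]; field_simp
  have hl0 : 0 ≤ l := by positivity
  have hlq : q * l ≤ 1 / 2 - 2 * ε := by
    refine le_of_mul_le_mul_left ?_ hR
    rw [show (r : ℝ) * (q * l) = q * (r * l) by ring, hlr]
    linarith
  have hlpq : p * q * l ≤ (1 / 4 - ε) * (p + q) - 1 / 2 := by
    refine le_of_mul_le_mul_left ?_ hR
    rw [show (r : ℝ) * (p * q * l) = p * q * (r * l) by ring, hlr]
    linarith
  have hε4 : ε ≤ 1 / 4 := by nlinarith [mul_nonneg hQ.le hl0]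
  obtain ⟨a, ha⟩ := exists_interval_farFromInt hp hpq hco hl0 hlq hlpq s₁ s₂
  obtain ⟨u, w, huw⟩ := hdr
  have huw' : (u : ℝ) * d + w * r = 1 := by exact_mod_cast huw
  set j : ℤ := ⌈d * (1 / 4 - ε - s₃) - r * a⌉
  have hj1 : d * (1 / 4 - ε - s₃) - r * a ≤ j := Int.le_ceil _
  have hj2 : (j : ℝ) < d * (1 / 4 - ε - s₃) - r * a + 1 := Int.ceil_lt_add_one _
  obtain ⟨t, ht1, ht2, ht3, ht4⟩ : ∃ t, a ≤ t ∧ t ≤ a + l ∧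
      d * (1 / 4 + ε) ≤ d * s₃ + r * t + j ∧ d * s₃ + r * t + j ≤ d * (3 / 4 - ε) := by
    by_cases hc : d * (1 / 4 + ε) ≤ d * s₃ + r * a + j
    · exact ⟨a, le_rfl, by linarith, hc, by nlinarith⟩
    · push Not at hc
      have e1 : r * ((d * (1 / 4 + ε) - j - d * s₃) / r) = d * (1 / 4 + ε) - j - d * s₃ := by
        field_simp
      refine ⟨(d * (1 / 4 + ε) - j - d * s₃) / r, ?_, ?_, ?_, ?_⟩
      · rw [le_div_iff₀ hR]
        linarith
      · rw [div_le_iff₀ hR]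
        linarith
      · linarith
      · nlinarith
  obtain ⟨hg1, hg2⟩ := ha t ht1 ht2
  refine ⟨(t + (j * w : ℤ)) / d, ?_, ?_, j * -u, ?_, ?_⟩
  · convert hg1.add_int (j * w * p) using 1
    push_cast
    field_simp
    ring
  · convert hg2.add_int (j * w * q) using 1
    push_cast
    field_simp
    ring
  all_goals
    have e2 : s₃ + (t + (j * w : ℤ)) / d * r = (d * s₃ + r * t + j) / d + (j * -u : ℤ) := by
      push_cast
      field_simp
      linear_combination (j : ℝ) * huw'
    rw [e2]
  · have : 1 / 4 + ε ≤ (d * s₃ + r * t + j) / d := by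
      rw [le_div_iff₀ hD]
      linarith
    linarith
  · have : (d * s₃ + r * t + j) / d ≤ 3 / 4 - ε := by
      rw [div_le_iff₀ hD]
      linarith
    linarith

theorem exists_farFromInt_of_not_coprime {p q r : ℤ} (hp : 0 < p) (hpq : p < q) (hr : 0 < r)
    (hgcd : ∀ d : ℤ, d ∣ p → d ∣ q → d ∣ r → IsUnit d) (hco : ¬ IsCoprime p q) :
    ∃ ε : ℝ, 0 < ε ∧ ∀ s₁ s₂ s₃ : ℝ, ∃ t : ℝ, FarFromInt ε (s₁ + t * p) ∧
      FarFromInt ε (s₂ + t * q) ∧ FarFromInt ε (s₃ + t * r) := by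
  have hg0 : 0 < Int.gcd p q := Int.gcd_pos_of_ne_zero_left _ hp.ne'
  have hg1 : Int.gcd p q ≠ 1 := fun h => hco (Int.isCoprime_iff_gcd_eq_one.mpr h)
  obtain ⟨p', hp'⟩ := Int.gcd_dvd_left p q
  obtain ⟨q', hq'⟩ := Int.gcd_dvd_right p q
  have hco' : IsCoprime p' q' := by
    rw [Int.isCoprime_iff_gcd_eq_one]
    have h := Int.gcd_mul_left (Int.gcd p q : ℤ) p' q'
    rw [← hp', ← hq', Int.natAbs_natCast] at h
    exact Nat.eq_of_mul_eq_mul_left hg0 (by linarith)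
  have hgr : IsCoprime (Int.gcd p q : ℤ) r := by
    refine isCoprime_of_dvd _ _ (fun h => by omega) fun z hz _ hz1 hz2 => hz ?_
    exact hgcd z (hz1.trans (Int.gcd_dvd_left _ _)) (hz1.trans (Int.gcd_dvd_right _ _)) hz2
  have hgz : (0 : ℤ) < Int.gcd p q := by exact_mod_cast hg0
  have hp0 : 0 < p' := by
    rw [hp'] at hp
    exact pos_of_mul_pos_right hp hgz.le
  have hpq' : p' < q' := by
    refine lt_of_mul_lt_mul_left ?_ hgz.le
    rwa [← hp', ← hq']
  have := exists_farFromInt_of_common_factor hp0 hpq' hr hco' (by omega) hgr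
  rwa [← hp', ← hq'] at this

theorem exists_farFromInt_of_lt {p q r : ℤ} (hp : 0 < p) (hpq : p < q) (hqr : q < r)
    (hgcd : ∀ d : ℤ, d ∣ p → d ∣ q → d ∣ r → IsUnit d) (hne : ¬ (p = 1 ∧ q = 2 ∧ r = 3)) :
    ∃ ε : ℝ, 0 < ε ∧ ∀ s₁ s₂ s₃ : ℝ, ∃ t : ℝ, FarFromInt ε (s₁ + t * p) ∧
      FarFromInt ε (s₂ + t * q) ∧ FarFromInt ε (s₃ + t * r) := by
  by_cases h1 : IsCoprime p q
  swap
  · exact exists_farFromInt_of_not_coprime hp hpq (by linarith) hgcd h1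
  by_cases h2 : IsCoprime p r
  swap
  · obtain ⟨ε, hε, h⟩ := exists_farFromInt_of_not_coprime hp (hpq.trans hqr) (hp.trans hpq)
      (fun d a b c => hgcd d a c b) h2
    refine ⟨ε, hε, fun s₁ s₂ s₃ => ?_⟩
    obtain ⟨t, ha, hb, hc⟩ := h s₁ s₃ s₂
    exact ⟨t, ha, hc, hb⟩
  by_cases h3 : IsCoprime q r
  swap
  · obtain ⟨ε, hε, h⟩ := exists_farFromInt_of_not_coprime (hp.trans hpq) hqr hp
      (fun d a b c => hgcd d c a b) h3
    refine ⟨ε, hε, fun s₁ s₂ s₃ => ?_⟩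
    obtain ⟨t, ha, hb, hc⟩ := h s₂ s₃ s₁
    exact ⟨t, hc, ha, hb⟩
  refine exists_farFromInt_of_coprime hp hpq hqr h1 ?_
  rcases (show p + 2 ≤ q ∨ q = p + 1 by omega) with hq | rfl
  · nlinarith
  rcases (show p = 1 ∨ p = 2 ∨ 3 ≤ p by omega) with rfl | rfl | hp3
  · have : r ≠ 4 := by
      rintro rfl
      revert h3
      rw [Int.isCoprime_iff_gcd_eq_one]
      decide
    omega
  · have : r ≠ 4 := by
      rintro rfl
      revert h2
      rw [Int.isCoprime_iff_gcd_eq_one]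
      decide
    omega
  · nlinarith

theorem stmt8 (v : Fin 3 → ℤ) (hpos : ∀ j, 0 < v j)
    (hinj : Function.Injective v)
    (hgcd : Finset.univ.gcd v = 1)
    (hne : ¬ ∃ σ : Equiv.Perm (Fin 3), v = ![1, 2, 3] ∘ σ) :
    ∃ ε : ℝ, 0 < ε ∧ ∀ s : Fin 3 → ℝ, ∃ t : ℝ, ∀ j, ∀ k : ℤ,
      (1 : ℝ) / 4 + ε ≤ |s j + t * (v j : ℝ) - (k : ℝ)| := by
  have hmono : StrictMono (v ∘ Tuple.sort v) :=
    (Tuple.monotone_sort v).strictMono_of_injective (hinj.comp (Tuple.sort v).injective)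
  generalize Tuple.sort v = σ at hmono
  have hdvd : ∀ d : ℤ, d ∣ v (σ 0) → d ∣ v (σ 1) → d ∣ v (σ 2) → IsUnit d := by
    intro d h0 h1 h2
    refine isUnit_of_dvd_one (hgcd ▸ Finset.dvd_gcd fun b _ => ?_)
    obtain ⟨i, rfl⟩ := σ.surjective b
    fin_cases i
    exacts [h0, h1, h2]
  have hne' : ¬ (v (σ 0) = 1 ∧ v (σ 1) = 2 ∧ v (σ 2) = 3) := by
    rintro ⟨h0, h1, h2⟩
    refine hne ⟨σ.symm, funext fun b => ?_⟩
    obtain ⟨i, rfl⟩ := σ.surjective b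
    fin_cases i <;> simp [h0, h1, h2]
  obtain ⟨ε, hε, h⟩ := exists_farFromInt_of_lt (hpos (σ 0))
    (hmono (show (0 : Fin 3) < 1 by decide)) (hmono (show (1 : Fin 3) < 2 by decide)) hdvd hne'
  refine ⟨ε, hε, fun s => ?_⟩
  obtain ⟨t, h0, h1, h2⟩ := h (s (σ 0)) (s (σ 1)) (s (σ 2))
  refine ⟨t, fun j => ?_⟩
  obtain ⟨i, rfl⟩ := σ.surjective j
  fin_cases i
  exacts [h0.le_abs_sub, h1.le_abs_sub, h2.le_abs_sub]
end

section
/- (Schoenberg) Given positive integer velocities v₁, …, v_d ∈ ℤ_{>0} and arbitrary starting points s₁, …, s_d ∈ ℝ, there exists a real number t such that for all j ∈ {1,…,d} the distance of s_j + t·v_j to the nearest integer is at least 1/(2d). -/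
open MeasureTheory in
/-- The points of the unit circle sent into the closed ball of radius `r` by a nonconstant affine
map have measure at most `2 * r`. -/
theorem UnitAddCircle.volume_norm_zsmul_add_le {n : ℤ} (hn : n ≠ 0) (a : UnitAddCircle) (r : ℝ) :
    volume {x : UnitAddCircle | ‖a + n • x‖ ≤ r} ≤ ENNReal.ofReal (2 * r) := by
  have hmp : MeasurePreserving (fun x : UnitAddCircle => n • x) volume volume :=
    Measure.measurePreserving_zsmul volume hn
  have hpre : {x : UnitAddCircle | ‖a + n • x‖ ≤ r} =
      (fun x : UnitAddCircle => n • x) ⁻¹' Metric.closedBall (-a) r := by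
    ext x
    simp [dist_eq_norm, add_comm]
  rw [hpre, hmp.measure_preimage Metric.isClosed_closedBall.measurableSet.nullMeasurableSet,
    AddCircle.volume_closedBall]
  exact ENNReal.ofReal_le_ofReal (min_le_right _ _)

open MeasureTheory in
/-- Nonconstant affine self-maps of the unit circle, `d` in number, simultaneously avoid the open
ball of radius `1 / (2 * d)` around zero at some point. -/
theorem UnitAddCircle.exists_forall_le_norm_zsmul_add {d : ℕ} (v : Fin d → ℤ)
    (hv : ∀ j, v j ≠ 0) (a : Fin d → UnitAddCircle) :
    ∃ x : UnitAddCircle, ∀ j, 1 / (2 * (d : ℝ)) ≤ ‖a j + v j • x‖ := by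
  rcases Nat.eq_zero_or_pos d with rfl | hd
  · exact ⟨0, fun j => j.elim0⟩
  have hd' : (0 : ℝ) < d := Nat.cast_pos.mpr hd
  have hne : (Finset.univ : Finset (Fin d)).Nonempty := ⟨⟨0, hd⟩, Finset.mem_univ _⟩
  let f : UnitAddCircle → ℝ := fun x => Finset.univ.inf' hne fun j => ‖a j + v j • x‖
  have hf : Continuous f :=
    Continuous.finset_inf'_apply hne fun j _ => by fun_prop
  obtain ⟨x₀, -, hx₀⟩ := isCompact_univ.exists_isMaxOn Set.univ_nonempty hf.continuousOn
  suffices h : 1 / (2 * (d : ℝ)) ≤ f x₀ from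
    ⟨x₀, fun j => h.trans (Finset.inf'_le _ (Finset.mem_univ j))⟩
  by_contra! hlt
  have hcover : (Set.univ : Set UnitAddCircle) ⊆ ⋃ j, {x | ‖a j + v j • x‖ ≤ f x₀} := by
    intro x _
    obtain ⟨j, -, hj⟩ := Finset.exists_mem_eq_inf' hne fun j => ‖a j + v j • x‖
    exact Set.mem_iUnion.mpr ⟨j, hj.symm.trans_le (hx₀ (Set.mem_univ x))⟩
  have hle : (1 : ENNReal) ≤ ENNReal.ofReal (d * (2 * f x₀)) :=
    calc (1 : ENNReal) = volume (Set.univ : Set UnitAddCircle) := by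
          simp
      _ ≤ ∑ j, volume {x : UnitAddCircle | ‖a j + v j • x‖ ≤ f x₀} :=
          (measure_mono hcover).trans (measure_iUnion_fintype_le _ _)
      _ ≤ ∑ _j : Fin d, ENNReal.ofReal (2 * f x₀) :=
          Finset.sum_le_sum fun j _ => volume_norm_zsmul_add_le (hv j) _ _
      _ = ENNReal.ofReal (d * (2 * f x₀)) := by
          simp [ENNReal.ofReal_mul hd'.le]
  rw [ENNReal.one_le_ofReal] at hle
  rw [lt_div_iff₀ (by positivity)] at hlt
  linarith

theorem stmt10 (d : ℕ) (v : Fin d → ℤ) (hv : ∀ j, 0 < v j)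
    (s : Fin d → ℝ) :
    ∃ t : ℝ, ∀ j, ∀ k : ℤ,
      1 / (2 * (d : ℝ)) ≤ |s j + t * (v j : ℝ) - (k : ℝ)| := by
  obtain ⟨x, hx⟩ := UnitAddCircle.exists_forall_le_norm_zsmul_add v (fun j => (hv j).ne')
    fun j => (s j : UnitAddCircle)
  obtain ⟨t, rfl⟩ := QuotientAddGroup.mk_surjective x
  refine ⟨t, fun j k => (hx j).trans ?_⟩
  have hcoe : (s j : UnitAddCircle) + v j • (t : UnitAddCircle) =
      ((s j + t * (v j : ℝ) : ℝ) : UnitAddCircle) := by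
    rw [AddCircle.coe_add, mul_comm, ← zsmul_eq_mul, AddCircle.coe_zsmul]
  exact (congrArg norm hcoe).trans_le (UnitAddCircle.norm_eq.trans_le (round_le _ k))
end

section
/- The bound 1/(2d) in Schoenberg's theorem cannot be improved: for the velocities v₁ = … = v_d = 1 and the starting points s_i = (i−1)/d for i = 1, …, d, and for every real number t, there exists j ∈ {1,…,d} such that the distance of s_j + t to the nearest integer is at most 1/(2d). -/
theorem stmt11 (d : ℕ) (hd : 0 < d) (t : ℝ) :
    ∃ j : Fin d, ∃ k : ℤ,
      |((j : ℕ) : ℝ) / (d : ℝ) + t - (k : ℝ)| ≤ 1 / (2 * (d : ℝ)) := by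
  have hd' : (0 : ℝ) < d := by exact_mod_cast hd
  have hdz : (0 : ℤ) < d := by exact_mod_cast hd
  set m : ℤ := round (d * t)
  have hm : |(d : ℝ) * t - m| ≤ 1 / 2 := abs_sub_round _
  obtain ⟨j, hj⟩ := Int.eq_ofNat_of_zero_le (Int.emod_nonneg (-m) hdz.ne')
  have hlt : j < d := by
    have := Int.emod_lt_of_pos (-m) hdz
    omega
  refine ⟨⟨j, hlt⟩, -(-m / d), ?_⟩
  have hjm : (j : ℝ) + d * ((-m / d : ℤ) : ℝ) = -m := by
    have h := Int.emod_add_mul_ediv (-m) d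
    rw [hj] at h
    exact_mod_cast h
  have key : (j : ℝ) / d + t - ((-(-m / d) : ℤ) : ℝ) = (d * t - m) / d := by
    rw [Int.cast_neg]
    field_simp
    linarith
  rw [key, abs_div, abs_of_pos hd', ← div_div]
  gcongr
end

section
/- For every v ∈ ℝ^d, the topological closure of the lattice arrangement of lines ℤ^d + ℝ·v equals the set 𝓔_v = {ξ ∈ ℝ^d : ℓᵀξ ∈ ℤ for every ℓ ∈ ℤ^d with ℓᵀv = 0}. -/
open MeasureTheory

namespace UnitAddTorus

variable {ι : Type*}

/-- The quotient map from `ℝ^ι` onto the torus. -/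
noncomputable def mk : (ι → ℝ) →+ UnitAddTorus ι where
  toFun x i := (x i : UnitAddCircle)
  map_zero' := rfl
  map_add' _ _ := rfl

theorem isOpenMap_mk : IsOpenMap (mk : (ι → ℝ) → UnitAddTorus ι) :=
  IsOpenMap.piMap (fun _ => QuotientAddGroup.isOpenMap_coe)
    (.of_forall fun _ => QuotientAddGroup.mk_surjective)

theorem continuous_mk : Continuous (mk : (ι → ℝ) → UnitAddTorus ι) :=
  continuous_pi fun i => (AddCircle.continuous_mk' 1).comp (continuous_apply i)

theorem mk_eq_mk_iff {x y : ι → ℝ} :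
    mk x = mk y ↔ ∃ z : ι → ℤ, x = (fun i => (z i : ℝ)) + y := by
  simp only [funext_iff, Pi.add_apply,
    ← Classical.skolem (p := fun i (k : ℤ) => x i = k + y i)]
  refine forall_congr' fun i => ?_
  change (x i : UnitAddCircle) = (y i : UnitAddCircle) ↔ _
  rw [← sub_eq_zero, ← AddCircle.coe_sub, AddCircle.coe_eq_zero_iff]
  refine exists_congr fun k => ?_
  rw [zsmul_one, eq_comm, sub_eq_iff_eq_add]

/-- The image in the torus of the line spanned by `v`. -/
noncomputable def line (v : ι → ℝ) : AddSubgroup (UnitAddTorus ι) :=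
  (mk.comp (LinearMap.toSpanSingleton ℝ (ι → ℝ) v).toAddMonoidHom).range

theorem mem_line {v : ι → ℝ} {x : UnitAddTorus ι} : x ∈ line v ↔ ∃ t : ℝ, mk (t • v) = x :=
  Iff.rfl

variable [Fintype ι]

theorem mFourier_add_apply (n : ι → ℤ) (x y : UnitAddTorus ι) :
    mFourier n (x + y) = mFourier n x * mFourier n y := by
  simp [mFourier, fourier_apply, AddCircle.toCircle_add, Finset.prod_mul_distrib]

theorem mFourier_coe_apply (n : ι → ℤ) (x : ι → ℝ) :
    mFourier n (fun i => (x i : UnitAddCircle)) =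
      Complex.exp ((∑ i, (n i : ℝ) * x i : ℝ) * (2 * Real.pi * Complex.I)) := by
  simp only [mFourier, ContinuousMap.coe_mk, fourier_coe_apply, ← Complex.exp_sum]
  congr 1
  push_cast
  rw [Finset.sum_mul]
  exact Finset.sum_congr rfl fun i _ => by ring

theorem mFourier_coe_eq_one_iff (n : ι → ℤ) (x : ι → ℝ) :
    mFourier n (fun i => (x i : UnitAddCircle)) = 1 ↔
      ∃ k : ℤ, ∑ i, (n i : ℝ) * x i = (k : ℝ) := by
  rw [mFourier_coe_apply, Complex.exp_eq_one_iff]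
  refine exists_congr fun k => ?_
  rw [mul_left_inj' Complex.two_pi_I_ne_zero]
  norm_cast

/-- The integral of a continuous function on the torus over the translate by `x` of a closed
subgroup. -/
noncomputable def translateIntegral (H : AddSubgroup (UnitAddTorus ι)) (μ : Measure H)
    [IsFiniteMeasure μ] (x : UnitAddTorus ι) : C(UnitAddTorus ι, ℂ) →L[ℂ] ℂ :=
  have integrable (f : C(UnitAddTorus ι, ℂ)) : Integrable (fun h : H => f (x + h)) μ :=
    Integrable.of_bound (by fun_prop) ‖f‖ (.of_forall fun _ => f.norm_coe_le_norm _)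
  LinearMap.mkContinuous
    { toFun f := ∫ h : H, f (x + h) ∂μ
      map_add' f g := integral_add (integrable f) (integrable g)
      map_smul' c f := integral_const_mul c _ }
    (μ.real Set.univ) fun f => by
      rw [mul_comm]
      exact norm_integral_le_of_norm_le_const (.of_forall fun _ => f.norm_coe_le_norm _)

theorem translateIntegral_apply (H : AddSubgroup (UnitAddTorus ι)) (μ : Measure H)
    [IsFiniteMeasure μ] (x : UnitAddTorus ι) (f : C(UnitAddTorus ι, ℂ)) :
    translateIntegral H μ x f = ∫ h : H, f (x + h) ∂μ := rfl

/-- A character which is nontrivial on a subgroup has vanishing integral over it. -/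
theorem integral_mFourier_eq_zero {H : AddSubgroup (UnitAddTorus ι)} (μ : Measure H)
    [μ.IsAddLeftInvariant] {n : ι → ℤ} {g : UnitAddTorus ι} (hg : g ∈ H)
    (hn : mFourier n g ≠ 1) : ∫ h : H, mFourier n h ∂μ = 0 := by
  have key := integral_add_left_eq_self (μ := μ) (fun h : H => mFourier n h) ⟨g, hg⟩
  simp only [AddSubgroup.coe_add, mFourier_add_apply, integral_const_mul] at key
  by_contra h
  exact hn ((mul_eq_right₀ h).mp key)

/-- A closed subgroup of the torus is cut out by the characters that are trivial on it. -/
theorem mem_of_forall_mFourier_eq_one {H : AddSubgroup (UnitAddTorus ι)}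
    (hH : IsClosed (H : Set (UnitAddTorus ι))) {x : UnitAddTorus ι}
    (hx : ∀ n : ι → ℤ, (∀ h ∈ H, mFourier n h = 1) → mFourier n x = 1) : x ∈ H := by
  by_contra hxH
  have : CompactSpace H := isCompact_iff_compactSpace.mp hH.isCompact
  let μ : Measure H := Measure.addHaar
  have heq : translateIntegral H μ x = translateIntegral H μ 0 := by
    refine ContinuousLinearMap.ext_on
      (Submodule.dense_iff_topologicalClosure_eq_top.mpr span_mFourier_closure_eq_top) ?_
    rintro _ ⟨n, rfl⟩
    simp only [translateIntegral_apply, mFourier_add_apply, zero_add, integral_const_mul]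
    by_cases hn : ∀ h ∈ H, mFourier n h = 1
    · rw [hx n hn, one_mul]
    · push Not at hn
      obtain ⟨g, hg, hng⟩ := hn
      rw [integral_mFourier_eq_zero μ hg hng, mul_zero]
  have hdisj : Disjoint ((x + ·) '' (H : Set (UnitAddTorus ι))) H := by
    rw [Set.disjoint_left]
    rintro _ ⟨h, hh, rfl⟩ hxh
    exact hxH ((H.add_mem_cancel_right hh).mp hxh)
  obtain ⟨f, hf₀, hf₁, -⟩ := exists_continuous_zero_one_of_isClosed
    ((Homeomorph.addLeft x).isClosedMap _ hH) hH hdisj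
  let F : C(UnitAddTorus ι, ℂ) := ⟨fun y => (f y : ℂ), by fun_prop⟩
  have hF := congrArg (fun Λ => Λ F) heq
  have h₀ (h : H) : F (x + h) = 0 := by
    simpa [F] using hf₀ (Set.mem_image_of_mem _ h.2)
  have h₁ (h : H) : F (0 + h) = 1 := by
    simpa [F] using hf₁ h.2
  simp only [zero_add] at h₁
  simp [translateIntegral_apply, h₀, h₁, eq_comm (a := (0 : ℂ)), measureReal_eq_zero_iff,
    NeZero.ne μ] at hF

theorem forall_mem_closure_line_mFourier_eq_one_iff (n : ι → ℤ) (v : ι → ℝ) :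
    (∀ h ∈ (line v).topologicalClosure, mFourier n h = 1) ↔ ∑ i, (n i : ℝ) * v i = 0 := by
  have hsum (t : ℝ) : ∑ i, (n i : ℝ) * (t • v) i = t * ∑ i, (n i : ℝ) * v i := by
    rw [Finset.mul_sum]
    exact Finset.sum_congr rfl fun i _ => by simp only [Pi.smul_apply, smul_eq_mul]; ring
  constructor
  · intro h
    by_contra hne
    obtain ⟨k, hk⟩ := (mFourier_coe_eq_one_iff n _).mp <|
      h _ ((line v).le_topologicalClosure (mem_line.mpr ⟨2⁻¹ * (∑ i, (n i : ℝ) * v i)⁻¹, rfl⟩))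
    rw [hsum, mul_assoc, inv_mul_cancel₀ hne] at hk
    have : (1 : ℝ) = (2 * k : ℤ) := by push_cast; linarith
    norm_cast at this
    lia
  · intro h x hx
    have hclosed : IsClosed {x : UnitAddTorus ι | mFourier n x = 1} :=
      isClosed_eq (by fun_prop) continuous_const
    refine closure_minimal ?_ hclosed hx
    rintro _ ⟨t, rfl⟩
    exact (mFourier_coe_eq_one_iff n _).mpr ⟨0, by
      simpa [h] using hsum t⟩

end UnitAddTorus

open UnitAddTorus in
theorem stmt12 (d : ℕ) (v : Fin d → ℝ) :
    closure {x : Fin d → ℝ | ∃ (z : Fin d → ℤ) (t : ℝ),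
        x = (fun i => (z i : ℝ)) + t • v} =
      {ξ : Fin d → ℝ | ∀ ℓ : Fin d → ℤ, (∑ i, (ℓ i : ℝ) * v i = 0) →
        ∃ k : ℤ, ∑ i, (ℓ i : ℝ) * ξ i = (k : ℝ)} := by
  have hpre : {x : Fin d → ℝ | ∃ (z : Fin d → ℤ) (t : ℝ), x = (fun i => (z i : ℝ)) + t • v} =
      mk ⁻¹' (line v : Set (UnitAddTorus (Fin d))) := by
    ext x
    simp only [Set.mem_ofPred_eq, Set.mem_preimage, SetLike.mem_coe, mem_line, eq_comm (b := mk x),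
      mk_eq_mk_iff]
    exact exists_comm
  rw [hpre, ← isOpenMap_mk.preimage_closure_eq_closure_preimage continuous_mk]
  ext ξ
  simp only [Set.mem_ofPred_eq, ← forall_mem_closure_line_mFourier_eq_one_iff,
    ← mFourier_coe_eq_one_iff]
  exact ⟨fun hξ n hn => hn _ hξ,
    mem_of_forall_mFourier_eq_one (line v).isClosed_topologicalClosure⟩
end

section
/- Let v ∈ ℝ^d have pairwise distinct positive coordinates. Then there exists an integer vector y ∈ ℤ^d with pairwise distinct positive coordinates such that 𝓔_y ⊆ 𝓔_v. -/
/-- A finite family of rationals has a common positive denominator. -/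
theorem exists_pos_int_mul_eq_intCast {ι : Type*} [Fintype ι] (w : ι → ℚ) :
    ∃ N : ℤ, 0 < N ∧ ∃ y : ι → ℤ, ∀ i, (y i : ℚ) = N * w i := by
  refine ⟨∏ i, ((w i).den : ℤ), Finset.prod_pos fun i _ => by exact_mod_cast (w i).den_pos, ?_⟩
  have h (i : ι) : ∃ z : ℤ, (z : ℚ) = ((∏ i, ((w i).den : ℤ) : ℤ) : ℚ) * w i := by
    obtain ⟨c, hc⟩ := Finset.dvd_prod_of_mem (fun i => ((w i).den : ℤ)) (Finset.mem_univ i)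
    refine ⟨c * (w i).num, ?_⟩
    rw [hc]
    push_cast
    rw [← Rat.mul_den_eq_num (w i)]
    ring
  exact ⟨fun i => (h i).choose, fun i => (h i).choose_spec⟩

/-- A finite injective family of positive reals can be replaced by a family of rationals with the
same properties that satisfies every rational linear relation of the original one. -/
theorem exists_rat_pos_injective_of_real {ι : Type*} [Fintype ι] (v : ι → ℝ)
    (hpos : ∀ i, 0 < v i) (hinj : Function.Injective v) :
    ∃ w : ι → ℚ, (∀ i, 0 < w i) ∧ Function.Injective w ∧
      ∀ c : ι → ℚ, ∑ i, (c i : ℝ) * v i = 0 → ∑ i, c i * w i = 0 := by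
  classical
  let V := Submodule.span ℚ (Set.range v)
  let u : ι → V := fun i => ⟨v i, Submodule.subset_span ⟨i, rfl⟩⟩
  have : Module.Finite ℚ V := Module.Finite.span_of_finite ℚ (Set.finite_range v)
  let b := Module.finBasis ℚ V
  let g (i : ι) (x : Fin (Module.finrank ℚ V) → ℝ) : ℝ := ∑ j, (b.repr (u i) j : ℝ) * x j
  have hg (i : ι) : Continuous (g i) := by fun_prop
  have hgv (i : ι) : g i (fun j => (b j : ℝ)) = v i := by
    calc g i (fun j => (b j : ℝ)) = V.subtype (∑ j, b.repr (u i) j • b j) := by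
          simp only [g, map_sum, map_smul, Rat.smul_def, Submodule.subtype_apply]
      _ = v i := by rw [b.sum_repr]; rfl
  let S : Set (Fin (Module.finrank ℚ V) → ℝ) :=
    {x | (∀ i, 0 < g i x) ∧ ∀ i j, i ≠ j → g i x ≠ g j x}
  have hS : IsOpen S := by
    simp only [S, Set.ofPred_and, Set.ofPred_forall]
    exact (isOpen_iInter_of_finite fun i => isOpen_lt continuous_const (hg i)).inter
      (isOpen_iInter_of_finite fun i => isOpen_iInter_of_finite fun j =>
        isOpen_iInter_of_finite fun _ => isOpen_ne_fun (hg i) (hg j))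
  have hne : S.Nonempty := ⟨fun j => (b j : ℝ), fun i => by rw [hgv]; exact hpos i,
    fun i j hij => by rw [hgv, hgv]; exact hinj.ne hij⟩
  obtain ⟨q, hq_pos, hq_ne⟩ :=
    (DenseRange.piMap fun _ : Fin (Module.finrank ℚ V) => Rat.denseRange_cast (𝕜 := ℝ)).exists_mem_open
      hS hne
  let f : V →ₗ[ℚ] ℚ := b.constr ℚ q
  have hf (i : ι) : ((f (u i) : ℚ) : ℝ) = g i (Pi.map (fun _ => Rat.cast) q) := by
    simp [f, g, Module.Basis.constr_apply_fintype]
  refine ⟨fun i => f (u i), fun i => ?_, fun i j hij => ?_, fun c hc => ?_⟩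
  · have := hq_pos i
    rw [← hf] at this
    exact_mod_cast this
  · by_contra hne
    exact hq_ne i j hne (by rw [← hf, ← hf]; exact congrArg _ hij)
  · have h : ∑ i, c i • u i = 0 := by
      apply Subtype.ext
      simpa [u, Rat.smul_def] using hc
    simpa using congrArg f h

theorem stmt13 (d : ℕ) (v : Fin d → ℝ) (hpos : ∀ i, 0 < v i)
    (hinj : Function.Injective v) :
    ∃ y : Fin d → ℤ, (∀ i, 0 < y i) ∧ Function.Injective y ∧
      {ξ : Fin d → ℝ | ∀ ℓ : Fin d → ℤ, (∑ i, ℓ i * y i = 0) →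
          ∃ k : ℤ, ∑ i, (ℓ i : ℝ) * ξ i = (k : ℝ)} ⊆
        {ξ : Fin d → ℝ | ∀ ℓ : Fin d → ℤ, (∑ i, (ℓ i : ℝ) * v i = 0) →
          ∃ k : ℤ, ∑ i, (ℓ i : ℝ) * ξ i = (k : ℝ)} := by
  obtain ⟨w, hw_pos, hw_inj, hw⟩ := exists_rat_pos_injective_of_real v hpos hinj
  obtain ⟨N, hN, y, hy⟩ := exists_pos_int_mul_eq_intCast w
  have hN' : (0 : ℚ) < N := by exact_mod_cast hN
  refine ⟨y, fun i => ?_, fun i j hij => ?_, fun ξ hξ ℓ hℓ => hξ ℓ ?_⟩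
  · have h : (0 : ℚ) < y i := by rw [hy]; exact mul_pos hN' (hw_pos i)
    exact_mod_cast h
  · apply hw_inj
    apply mul_left_cancel₀ hN'.ne'
    rw [← hy, ← hy, hij]
  · have h := hw (fun i => ℓ i) (by simpa using hℓ)
    have h' : ∑ i, (ℓ i : ℚ) * y i = 0 := by
      calc ∑ i, (ℓ i : ℚ) * y i = N * ∑ i, (ℓ i : ℚ) * w i := by
            rw [Finset.mul_sum]
            exact Finset.sum_congr rfl fun i _ => by rw [hy]; ring
        _ = 0 := by rw [h, mul_zero]
    exact_mod_cast h'
end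

section
/- Let v = (v₁, …, v_d) ∈ ℤ^d have positive coordinates with gcd(v₁, …, v_d) = 1, and let A be a (d−1)×d integer matrix whose rows form a ℤ-basis of the lattice ℤ^d ∩ v^⊥. Then for each i ∈ {1,…,d}, the absolute value of the determinant of the (d−1)×(d−1) matrix obtained from A by deleting its i-th column equals v_i. -/
/-- If the rows `r k` generate the integer vectors orthogonal to `v` and `∑ i, u i * v i = 1`, then
adding `u` as a first row yields a unimodular matrix. -/
theorem isUnit_det_vecCons_of_generates_orthogonal {m : ℕ} {u v : Fin (m + 1) → ℤ}
    {r : Fin m → Fin (m + 1) → ℤ} (huv : u ⬝ᵥ v = 1)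
    (hgen : ∀ w : Fin (m + 1) → ℤ, w ⬝ᵥ v = 0 → ∃ c : Fin m → ℤ, w = ∑ k, c k • r k) :
    IsUnit (Matrix.of (Matrix.vecCons u r)).det := by
  have hrow (w : Fin (m + 1) → ℤ) :
      ∃ c : Fin (m + 1) → ℤ, Matrix.vecMul c (Matrix.of (Matrix.vecCons u r)) = w := by
    obtain ⟨c, hc⟩ := hgen (w - (w ⬝ᵥ v) • u) (by
      rw [sub_dotProduct, smul_dotProduct, huv, smul_eq_mul, mul_one, sub_self])
    refine ⟨Matrix.vecCons (w ⬝ᵥ v) c, ?_⟩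
    rw [Matrix.cons_vecMul_cons, Matrix.vecMul_eq_sum]
    exact (congrArg (_ + ·) hc.symm).trans (add_sub_cancel _ _)
  rw [← Matrix.isUnit_iff_isUnit_det]
  exact Matrix.vecMul_surjective_iff_isUnit.mp hrow

/-- If `v` is orthogonal to the rows `r k` and `u ⬝ᵥ v = 1`, then the coordinates of `v` are, up to
sign and the determinant of the matrix with rows `u` and `r k`, the maximal minors of `r`. -/
theorem det_vecCons_mul_eq_det_submatrix {R : Type*} [CommRing R] {m : ℕ} {u v : Fin (m + 1) → R}
    {r : Fin m → Fin (m + 1) → R} (huv : u ⬝ᵥ v = 1) (horth : ∀ k, r k ⬝ᵥ v = 0)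
    (i : Fin (m + 1)) :
    (Matrix.of (Matrix.vecCons u r)).det * v i =
      (-1) ^ (i : ℕ) * (Matrix.of fun k l : Fin m => r k (i.succAbove l)).det := by
  set B := Matrix.of (Matrix.vecCons u r) with hB
  have hBv : B.mulVec v = Pi.single 0 1 := by
    ext j
    refine Fin.cases ?_ (fun k => ?_) j
    · simpa [hB, Matrix.mulVec] using huv
    · simpa [hB, Matrix.mulVec] using horth k
  have h : (B.adjugate.mulVec (B.mulVec v)) i = B.det * v i := by
    simp [Matrix.mulVec_mulVec, Matrix.adjugate_mul, Matrix.smul_mulVec]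
  rw [← h, hBv, Matrix.mulVec_single_one, Matrix.col_apply,
    Matrix.adjugate_fin_succ_eq_det_submatrix]
  simp only [Fin.val_zero, zero_add]
  rfl


theorem stmt14 (m : ℕ) (v : Fin (m + 1) → ℤ) (hpos : ∀ i, 0 < v i)
    (hgcd : Finset.univ.gcd v = 1)
    (r : Fin m → Fin (m + 1) → ℤ)
    -- the rows `r k` lie in the lattice `ℤ^d ∩ v^⊥` ...
    (horth : ∀ k, ∑ i, r k i * v i = 0)
    -- ... and form a ℤ-basis of it
    (hbasis : ∀ w : Fin (m + 1) → ℤ, (∑ i, w i * v i = 0) →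
      ∃! c : Fin m → ℤ, w = fun i => ∑ k, c k * r k i) :
    ∀ i : Fin (m + 1),
      |(Matrix.of fun k l : Fin m => r k (i.succAbove l)).det| = v i := by
  intro i
  obtain ⟨u, hu⟩ := Finset.univ.gcd_eq_sum_mul v
  have huv : u ⬝ᵥ v = 1 := (dotProduct_comm u v).trans (hu.symm.trans hgcd)
  have hunit : IsUnit (Matrix.of (Matrix.vecCons u r)).det := by
    refine isUnit_det_vecCons_of_generates_orthogonal huv fun w hw => ?_
    obtain ⟨c, hc, -⟩ := hbasis w hw
    exact ⟨c, hc.trans (by ext; simp)⟩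
  have h := congrArg abs (det_vecCons_mul_eq_det_submatrix huv horth i)
  rw [abs_mul, abs_mul, abs_pow, abs_neg, abs_one, one_pow, one_mul,
    Int.isUnit_iff_abs_eq.mp hunit, one_mul, abs_of_pos (hpos i)] at h
  exact h.symm
end

section
/- Let v = (v₁, …, v_d) ∈ ℤ^d have positive coordinates with gcd(v₁, …, v_d) = 1, let A be a (d−1)×d integer matrix whose rows form a ℤ-basis of the lattice ℤ^d ∩ v^⊥, and let u₁, …, u_d ∈ ℤ^{d−1} be the columns of A. Then the (d−1)-dimensional Lebesgue measure of the zonotope Z_v = Σ_{j=1}^d [0, u_j] ⊆ ℝ^{d−1} equals v₁ + v₂ + … + v_d. -/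
/-- Rows completing a `ℤ`-basis of `v^⊥` to a basis of `ℤ^{m+1}`, given together with the
expansion of the standard basis vectors in the completed basis. -/
theorem exists_completion_of_orthogonal_basis {m : ℕ} {v : Fin (m + 1) → ℤ}
    (hgcd : Finset.univ.gcd v = 1) {r : Fin m → Fin (m + 1) → ℤ}
    (hspan : ∀ w : Fin (m + 1) → ℤ, (∑ i, w i * v i = 0) →
      ∃ c : Fin m → ℤ, w = fun i => ∑ k, c k * r k i) :
    ∃ (w : Fin (m + 1) → ℤ) (c : Fin (m + 1) → Fin m → ℤ), (∑ i, w i * v i = 1) ∧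
      ∀ i j, (1 : Matrix (Fin (m + 1)) (Fin (m + 1)) ℤ) i j
        = v i * w j + ∑ k, c i k * r k j := by
  obtain ⟨w, hw⟩ := Finset.gcd_eq_sum_mul Finset.univ v
  have hw1 : ∑ i, w i * v i = 1 := by
    rw [← hgcd, hw]
    exact Finset.sum_congr rfl fun i _ => mul_comm _ _
  have hdiff (i : Fin (m + 1)) :
      ∑ j, ((1 : Matrix (Fin (m + 1)) (Fin (m + 1)) ℤ) i j - v i * w j) * v j = 0 := by
    simp only [sub_mul, Finset.sum_sub_distrib, mul_assoc, ← Finset.mul_sum, hw1]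
    simp [Matrix.one_apply]
  choose c hc using fun i => hspan _ (hdiff i)
  exact ⟨w, c, hw1, fun i j => eq_add_of_sub_eq' (congrFun (hc i) j)⟩

/-- The maximal minors of a `ℤ`-basis of `v^⊥` are, up to sign, the coordinates of `v`. -/
theorem abs_det_orthogonal_basis_minor {m : ℕ} {v : Fin (m + 1) → ℤ}
    {r : Fin m → Fin (m + 1) → ℤ} (horth : ∀ k, ∑ i, r k i * v i = 0)
    {w : Fin (m + 1) → ℤ} {c : Fin (m + 1) → Fin m → ℤ} (hw : ∑ i, w i * v i = 1)
    (hc : ∀ i j, (1 : Matrix (Fin (m + 1)) (Fin (m + 1)) ℤ) i j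
      = v i * w j + ∑ k, c i k * r k j) (j : Fin (m + 1)) :
    |(Matrix.of fun k i => r k (j.succAbove i)).det| = |v j| := by
  let M : Matrix (Fin (m + 1)) (Fin (m + 1)) ℤ := Matrix.of (Fin.cons w r)
  let N : Matrix (Fin (m + 1)) (Fin (m + 1)) ℤ := Matrix.of fun i => Fin.cons (v i) (c i)
  have hNM : N * M = 1 := by
    ext i j
    rw [hc i j, Matrix.mul_apply, Fin.sum_univ_succ]
    simp [N, M]
  have hdet : |M.det| = 1 := by
    refine Int.isUnit_iff_abs_eq.mp (IsUnit.of_mul_eq_one N.det ?_)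
    rw [mul_comm, ← Matrix.det_mul, hNM, Matrix.det_one]
  have hMv : M.mulVec v = Pi.single 0 1 := by
    ext i
    refine Fin.cases ?_ (fun k => ?_) i
    · simpa [M, Matrix.mulVec, dotProduct] using hw
    · simpa [M, Matrix.mulVec, dotProduct] using horth k
  have hadj : M.det * v j = M.adjugate j 0 := by
    have h := congrFun (congrArg (M.adjugate.mulVec) hMv) j
    rw [Matrix.mulVec_mulVec, Matrix.adjugate_mul] at h
    simpa [Matrix.smul_mulVec] using h
  have hsub : M.submatrix (Fin.succAbove 0) j.succAbove
      = Matrix.of fun k i => r k (j.succAbove i) := by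
    ext k i
    simp [M]
  rw [Matrix.adjugate_fin_succ_eq_det_submatrix, hsub] at hadj
  have h := congrArg abs hadj
  rw [abs_mul, abs_mul, hdet, abs_pow] at h
  simpa using h.symm

/-- The real kernel of a `ℤ`-basis of `v^⊥` is the line spanned by `v`. -/
theorem eq_smul_of_orthogonal_basis {m : ℕ} {v : Fin (m + 1) → ℤ}
    {r : Fin m → Fin (m + 1) → ℤ} {w : Fin (m + 1) → ℤ} {c : Fin (m + 1) → Fin m → ℤ}
    (hc : ∀ i j, (1 : Matrix (Fin (m + 1)) (Fin (m + 1)) ℤ) i j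
      = v i * w j + ∑ k, c i k * r k j)
    {y : Fin (m + 1) → ℝ} (hy : ∀ k, ∑ j, (r k j : ℝ) * y j = 0) (i : Fin (m + 1)) :
    y i = (∑ j, (w j : ℝ) * y j) * v i := by
  have hcR (j : Fin (m + 1)) : (1 : Matrix (Fin (m + 1)) (Fin (m + 1)) ℝ) i j
      = v i * w j + ∑ k, (c i k : ℝ) * r k j := by
    have h := congrArg (Int.cast : ℤ → ℝ) (hc i j)
    push_cast [Matrix.one_apply] at h
    simpa [Matrix.one_apply] using h
  calc y i = ∑ j, (1 : Matrix (Fin (m + 1)) (Fin (m + 1)) ℝ) i j * y j := by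
        simp [Matrix.one_apply]
    _ = (∑ j, (w j : ℝ) * y j) * v i + ∑ k, (c i k : ℝ) * ∑ j, (r k j : ℝ) * y j := by
        simp only [hcR, add_mul, Finset.sum_add_distrib, Finset.sum_mul, Finset.mul_sum]
        rw [Finset.sum_comm]
        congr 1
        · exact Finset.sum_congr rfl fun j _ => by ring
        · exact Finset.sum_congr rfl fun k _ => Finset.sum_congr rfl fun j _ => by ring
    _ = (∑ j, (w j : ℝ) * y j) * v i := by simp [hy]

/-- Two nonnegative vectors, each vanishing somewhere, that differ by a multiple of a positive
vector are equal. -/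
theorem eq_of_sub_eq_smul_pos {ι : Type*} {v x y : ι → ℝ} (hv : ∀ i, 0 < v i)
    (hx : ∀ i, 0 ≤ x i) (hy : ∀ i, 0 ≤ y i) {i j : ι} (hxi : x i = 0) (hyj : y j = 0) {s : ℝ}
    (h : ∀ l, x l - y l = s * v l) : x = y := by
  have hs : s = 0 := by
    apply le_antisymm
    · nlinarith [h i, hy i, hv i]
    · nlinarith [h j, hx j, hv j]
  funext l
  simpa [hs, sub_eq_zero] using h l

theorem stmt15 (m : ℕ) (v : Fin (m + 1) → ℤ) (hpos : ∀ i, 0 < v i)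
    (hgcd : Finset.univ.gcd v = 1)
    (r : Fin m → Fin (m + 1) → ℤ)
    -- the rows `r k` lie in the lattice `ℤ^d ∩ v^⊥` ...
    (horth : ∀ k, ∑ i, r k i * v i = 0)
    -- ... and form a ℤ-basis of it
    (hbasis : ∀ w : Fin (m + 1) → ℤ, (∑ i, w i * v i = 0) →
      ∃! c : Fin m → ℤ, w = fun i => ∑ k, c k * r k i)
    -- the zonotope generated by the columns of the matrix with rows `r k`
    (Z : Set (Fin m → ℝ))
    (hZ : Z = {x : Fin m → ℝ | ∃ t : Fin (m + 1) → ℝ,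
      (∀ j, t j ∈ Set.Icc (0 : ℝ) 1) ∧
      x = ∑ j, t j • fun k => (r k j : ℝ)}) :
    MeasureTheory.volume Z = ENNReal.ofReal (∑ i, (v i : ℝ)) := by
  obtain ⟨w, c, hw, hc⟩ :=
    exists_completion_of_orthogonal_basis hgcd fun w hw => (hbasis w hw).exists
  have hv (i : Fin (m + 1)) : (0 : ℝ) < v i := Int.cast_pos.mpr (hpos i)
  let B (j : Fin (m + 1)) : Matrix (Fin m) (Fin m) ℝ :=
    Matrix.of fun k i => (r k (j.succAbove i) : ℝ)
  let P (I : Set ℝ) (j : Fin (m + 1)) : Set (Fin m → ℝ) :=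
    (Matrix.toLin' (B j)) '' Set.univ.pi fun _ => I
  have hdet (j : Fin (m + 1)) : |(B j).det| = v j := by
    have hB : B j = (Matrix.of fun k i => r k (j.succAbove i)).map (Int.castRingHom ℝ) := rfl
    rw [hB, ← RingHom.mapMatrix_apply, ← RingHom.map_det, eq_intCast, ← Int.cast_abs,
      abs_det_orthogonal_basis_minor horth hw hc, abs_of_pos (hpos j)]
  have hvol {I : Set ℝ} (hI : MeasureTheory.volume I = 1) (j : Fin (m + 1)) :
      MeasureTheory.volume (P I j) = ENNReal.ofReal (v j) := by
    rw [MeasureTheory.Measure.addHaar_image_linearMap, LinearMap.det_toLin', hdet,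
      MeasureTheory.volume_pi_pi]
    simp [hI]
  have hinsert (j : Fin (m + 1)) (s : Fin m → ℝ) (k : Fin m) :
      Matrix.toLin' (B j) s k = ∑ l, (r k l : ℝ) * j.insertNth (α := fun _ => ℝ) 0 s l := by
    rw [Fin.sum_univ_succAbove _ j]
    simp [B, Matrix.mulVec, dotProduct]
  have hsum : ENNReal.ofReal (∑ i, (v i : ℝ)) = ∑ i, ENNReal.ofReal (v i) :=
    ENNReal.ofReal_sum_of_nonneg fun i _ => (hv i).le
  have hmem (x : Fin m → ℝ) : x ∈ Z ↔ ∃ t : Fin (m + 1) → ℝ,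
      (∀ j, t j ∈ Set.Icc (0 : ℝ) 1) ∧ ∀ k, x k = ∑ j, (r k j : ℝ) * t j := by
    simp [hZ, funext_iff, mul_comm]
  apply le_antisymm
  · have hcover : Z ⊆ ⋃ j, P (Set.Icc 0 1) j := by
      intro x hx
      obtain ⟨t, ht, hxt⟩ := (hmem x).mp hx
      obtain ⟨j, -, hj⟩ :=
        Finset.exists_min_image Finset.univ (fun i => t i / v i) Finset.univ_nonempty
      have hs : 0 ≤ t j / v j := div_nonneg (ht j).1 (hv j).le
      refine Set.mem_iUnion.mpr ⟨j, fun i => t (j.succAbove i) - t j / v j * v (j.succAbove i),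
        fun i _ => ⟨?_, ?_⟩, ?_⟩
      · exact sub_nonneg.mpr ((le_div_iff₀ (hv _)).mp (hj _ (Finset.mem_univ _)))
      · linarith [(ht (j.succAbove i)).2, mul_nonneg hs (hv (j.succAbove i)).le]
      · funext k
        have hins : j.insertNth (α := fun _ => ℝ) 0
            (fun i => t (j.succAbove i) - t j / v j * v (j.succAbove i))
            = fun l => t l - t j / v j * v l := by
          rw [Fin.insertNth_eq_iff]
          exact ⟨by field_simp [(hv j).ne']; simp, rfl⟩
        have horthR : ∑ l, (r k l : ℝ) * v l = 0 := by exact_mod_cast horth k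
        rw [hinsert, hins, hxt]
        simp only [mul_sub, Finset.sum_sub_distrib, mul_left_comm _ (t j / (v j : ℝ)),
          ← Finset.mul_sum, horthR, mul_zero, sub_zero]
    calc MeasureTheory.volume Z ≤ ∑ j, MeasureTheory.volume (P (Set.Icc 0 1) j) :=
          (MeasureTheory.measure_mono hcover).trans
            (MeasureTheory.measure_iUnion_fintype_le _ _)
      _ = ENNReal.ofReal (∑ i, (v i : ℝ)) := by
          rw [hsum]
          exact Finset.sum_congr rfl fun j _ => hvol (by simp) j
  · have hsub : ⋃ j, P (Set.Ioc 0 1) j ⊆ Z := by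
      refine Set.iUnion_subset fun j => ?_
      rintro _ ⟨s, hs, rfl⟩
      refine (hmem _).mpr ⟨j.insertNth (α := fun _ => ℝ) 0 s, ?_, hinsert j s⟩
      rw [Fin.forall_iff_succAbove j]
      exact ⟨by simp, fun i => by simpa using Set.Ioc_subset_Icc_self (hs i trivial)⟩
    have hdisj : Pairwise (Function.onFun Disjoint (P (Set.Ioc 0 1))) := by
      intro i j hij
      refine Set.disjoint_left.mpr ?_
      rintro _ ⟨s, hs, rfl⟩ ⟨s', hs', heq⟩
      have hnonneg {l : Fin (m + 1)} {a : Fin m → ℝ} (ha : a ∈ Set.univ.pi fun _ => Set.Ioc 0 1) :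
          ∀ n, 0 ≤ l.insertNth (α := fun _ => ℝ) 0 a n := by
        rw [Fin.forall_iff_succAbove l]
        exact ⟨by simp, fun n => by simpa using (ha n trivial).1.le⟩
      have hker (k : Fin m) : ∑ l, (r k l : ℝ) * (i.insertNth (α := fun _ => ℝ) 0 s l
          - j.insertNth (α := fun _ => ℝ) 0 s' l) = 0 := by
        simp only [mul_sub, Finset.sum_sub_distrib, ← hinsert]
        rw [heq, sub_self]
      have h := eq_of_sub_eq_smul_pos hv (hnonneg hs) (hnonneg hs') (i := i) (j := j)
        (by simp) (by simp) (eq_smul_of_orthogonal_basis hc hker)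
      obtain ⟨n, hn⟩ := Fin.exists_succAbove_eq hij.symm
      have hj := congrFun h j
      rw [Fin.insertNth_apply_same, ← hn, Fin.insertNth_apply_succAbove] at hj
      exact (hs n trivial).1.ne' hj
    have hmeas (j : Fin (m + 1)) : MeasurableSet (P (Set.Ioc 0 1) j) := by
      have hunit : IsUnit (B j) := by
        rw [Matrix.isUnit_iff_isUnit_det, isUnit_iff_ne_zero, ← abs_ne_zero, hdet]
        exact (hv j).ne'
      exact (MeasurableSet.univ_pi fun _ => measurableSet_Ioc).image_of_continuousOn_injOn
        (LinearMap.continuous_of_finiteDimensional _).continuousOn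
        (Matrix.mulVec_injective_iff_isUnit.mpr hunit).injOn
    calc ENNReal.ofReal (∑ i, (v i : ℝ))
        = ∑ j, MeasureTheory.volume (P (Set.Ioc 0 1) j) := by
          rw [hsum]
          exact Finset.sum_congr rfl fun j _ => (hvol (by simp) j).symm
      _ = MeasureTheory.volume (⋃ j, P (Set.Ioc 0 1) j) := by
          rw [MeasureTheory.measure_iUnion hdisj hmeas, tsum_fintype]
      _ ≤ MeasureTheory.volume Z := MeasureTheory.measure_mono hsub
end

section
/- Let v₁, v₂, v₃ be positive integers and let κ, λ be integers divisible by v₃ such that v₃ = κ·v₁ + λ·v₂. Then the two rows (v₂, −v₁, 0) and (κ, λ, −1) form a ℤ-basis of the lattice ℤ³ ∩ v^⊥, where v = (v₁, v₂, v₃). -/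
theorem stmt16 (v₁ v₂ v₃ κ μ : ℤ) (h1 : 0 < v₁) (h2 : 0 < v₂) (h3 : 0 < v₃)
    (hκ : v₃ ∣ κ) (hμ : v₃ ∣ μ) (hrep : v₃ = κ * v₁ + μ * v₂)
    (v : Fin 3 → ℤ) (hv : v = ![v₁, v₂, v₃])
    (r : Fin 2 → Fin 3 → ℤ) (hr : r = ![![v₂, -v₁, 0], ![κ, μ, -1]]) :
    -- the two rows lie in the lattice `ℤ³ ∩ v^⊥` ...
    (∀ k, ∑ i, r k i * v i = 0) ∧
    -- ... and form a ℤ-basis of it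
    (∀ w : Fin 3 → ℤ, (∑ i, w i * v i = 0) →
      ∃! c : Fin 2 → ℤ, w = fun i => ∑ k, c k * r k i) := by
  subst hv hr
  obtain ⟨a, rfl⟩ := hκ
  obtain ⟨b, rfl⟩ := hμ
  have hab : a * v₁ + b * v₂ = 1 := by
    apply mul_left_cancel₀ h3.ne'
    linear_combination -hrep
  refine ⟨fun k => ?_, fun w hw => ?_⟩
  · fin_cases k
    · simp [Fin.sum_univ_three]
      ring
    · simp [Fin.sum_univ_three]
      linear_combination -hrep
  · simp only [Fin.sum_univ_three, Matrix.cons_val] at hw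
    have hw' : (w 0 + w 2 * (v₃ * a)) * v₁ + (w 1 + w 2 * (v₃ * b)) * v₂ = 0 := by
      linear_combination hw + w 2 * v₃ * hab
    refine ⟨![b * (w 0 + w 2 * (v₃ * a)) - a * (w 1 + w 2 * (v₃ * b)), -w 2], ?_, fun c hc => ?_⟩
    · funext i
      fin_cases i
      · simp [Fin.sum_univ_two]
        linear_combination a * hw' - (w 0 + w 2 * (v₃ * a)) * hab
      · simp [Fin.sum_univ_two]
        linear_combination b * hw' - (w 1 + w 2 * (v₃ * b)) * hab
      · simp [Fin.sum_univ_two]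
    · have e0 := congrFun hc 0
      have e2 := congrFun hc 2
      simp [Fin.sum_univ_two] at e0 e2
      have hc1 : c 1 = -w 2 := by linarith
      funext k
      fin_cases k
      · apply mul_right_cancel₀ h2.ne'
        change c 0 * v₂ =
          (b * (w 0 + w 2 * (v₃ * a)) - a * (w 1 + w 2 * (v₃ * b))) * v₂
        rw [hc1] at e0
        linear_combination -e0 + a * hw' - (w 0 + w 2 * (v₃ * a)) * hab
      · simpa using hc1
end

section
/- Let u₁, u₂, u₃ ∈ ℤ² be three lattice vectors in general linear position, i.e., any two of them are linearly independent. Then the zonotope Z = [0, u₁] + [0, u₂] + [0, u₃] ⊆ ℝ² contains a point of ℤ² in its interior; consequently, its lattice-width satisfies w(Z) ≥ 2. -/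
/-- Two linearly independent vectors of `ℤ²` have nonzero determinant. -/
theorem det_ne_zero_of_linearly_independent {v w : Fin 2 → ℤ}
    (h : ∀ c₁ c₂ : ℤ, (∀ i, c₁ * v i + c₂ * w i = 0) → c₁ = 0 ∧ c₂ = 0) :
    v 0 * w 1 - v 1 * w 0 ≠ 0 := by
  intro hd
  obtain ⟨hw0, hv0⟩ := h (w 0) (-v 0) (by
    rw [Fin.forall_fin_two]; constructor <;> linarith)
  obtain ⟨hw1, hv1⟩ := h (w 1) (-v 1) (by
    rw [Fin.forall_fin_two]; constructor <;> linarith)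
  have := h 1 0 (by rw [Fin.forall_fin_two]; constructor <;> linarith)
  exact one_ne_zero this.1

/-- A nonzero integer vector is not orthogonal to two vectors with nonzero determinant. -/
theorem dot_ne_zero_or_dot_ne_zero {v w z : Fin 2 → ℤ} (hd : v 0 * w 1 - v 1 * w 0 ≠ 0)
    (hz : z ≠ 0) : ∑ i, v i * z i ≠ 0 ∨ ∑ i, w i * z i ≠ 0 := by
  by_contra! h
  obtain ⟨hv, hw⟩ := h
  rw [Fin.sum_univ_two] at hv hw
  apply hz
  funext i
  apply (mul_eq_zero.mp _).resolve_left hd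
  revert i
  rw [Fin.forall_fin_two]
  constructor
  · linear_combination w 1 * hv - v 1 * hw
  · linear_combination v 0 * hw - w 0 * hv

/-- If a surjective linear map on `ℝ^ι` kills an integer vector without zero entries, then the
image of the unit cube has the image of a vertex of the cube in its interior. -/
theorem exists_vertex_mem_interior_image_cube {ι E : Type*} [Fintype ι] [AddCommGroup E]
    [Module ℝ E] [TopologicalSpace E] [IsTopologicalAddGroup E] [ContinuousSMul ℝ E] [T2Space E]
    [FiniteDimensional ℝ E] (L : (ι → ℝ) →ₗ[ℝ] E) (hL : Function.Surjective L)
    (a : ι → ℝ) (ha : ∀ j, a j ≠ 0) (haL : L a = 0) :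
    ∃ e : ι → ℤ, L (fun j => (e j : ℝ)) ∈ interior (L '' Set.univ.pi fun _ => Set.Icc 0 1) := by
  classical
  set S : ℝ := ∑ j, |a j| + 1 with hS
  have hlt : ∀ j, |a j| < S := fun j => by
    have := Finset.single_le_sum (f := fun j => |a j|) (fun i _ => abs_nonneg _)
      (Finset.mem_univ j)
    linarith
  have hSpos : 0 < S := by positivity
  have hopen : IsOpen (L '' Set.univ.pi fun _ => Set.Ioo (0 : ℝ) 1) :=
    L.isOpenMap_of_finiteDimensional hL _ (isOpen_set_pi Set.finite_univ fun _ _ => isOpen_Ioo)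
  refine ⟨fun j => if a j < 0 then 1 else 0, interior_maximal
    (Set.image_mono (Set.pi_mono fun _ _ => Set.Ioo_subset_Icc_self)) hopen ?_⟩
  refine ⟨(fun j => ((if a j < 0 then 1 else 0 : ℤ) : ℝ)) + S⁻¹ • a, fun j _ => ?_, ?_⟩
  · have habs : |S⁻¹ * a j| < 1 := by
      rw [abs_mul, abs_of_pos (inv_pos.mpr hSpos), inv_mul_lt_iff₀ hSpos, mul_one]
      exact hlt j
    have hb := abs_lt.mp habs
    simp only [Pi.add_apply, Pi.smul_apply, smul_eq_mul, Set.mem_Ioo]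
    rcases lt_or_gt_of_ne (ha j) with h | h
    · have := mul_neg_of_pos_of_neg (inv_pos.mpr hSpos) h
      simp only [h, if_true, Int.cast_one]
      constructor <;> linarith
    · have := mul_pos (inv_pos.mpr hSpos) h
      simp only [h.not_gt, if_false, Int.cast_zero]
      constructor <;> linarith
  · rw [map_add, map_smul, haL, smul_zero, add_zero]

/-- A linear functional on the unit cube has range of length at least the `ℓ¹`-norm of its
coefficients. -/
theorem sum_abs_le_sSup_sub_sInf_cube {ι : Type*} [Fintype ι] (a : ι → ℝ) :
    ∑ j, |a j| ≤ sSup ((fun t : ι → ℝ => ∑ j, t j * a j) '' Set.univ.pi fun _ => Set.Icc 0 1) -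
      sInf ((fun t : ι → ℝ => ∑ j, t j * a j) '' Set.univ.pi fun _ => Set.Icc 0 1) := by
  classical
  have hK : IsCompact ((fun t : ι → ℝ => ∑ j, t j * a j) ''
      Set.univ.pi fun _ => Set.Icc (0 : ℝ) 1) :=
    (isCompact_univ_pi fun _ => isCompact_Icc).image (by fun_prop)
  have hsup := le_csSup hK.bddAbove
    (Set.mem_image_of_mem _ (x := fun j => if 0 ≤ a j then (1 : ℝ) else 0)
      (fun j _ => by dsimp only; split_ifs <;> simp))
  have hinf := csInf_le hK.bddBelow
    (Set.mem_image_of_mem _ (x := fun j => if 0 ≤ a j then (0 : ℝ) else 1)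
      (fun j _ => by dsimp only; split_ifs <;> simp))
  have hsum : ∑ j, |a j| = ∑ j, (if 0 ≤ a j then (1 : ℝ) else 0) * a j -
      ∑ j, (if 0 ≤ a j then (0 : ℝ) else 1) * a j := by
    rw [← Finset.sum_sub_distrib]
    refine Finset.sum_congr rfl fun j _ => ?_
    split_ifs with h
    · simp [abs_of_nonneg h]
    · simp [abs_of_neg (not_le.mp h)]
  rw [hsum]
  exact sub_le_sub hsup hinf

/-- Three integers no two of which vanish have absolute values summing to at least `2`. -/
theorem two_le_sum_abs {b : Fin 3 → ℤ} (hb : ∀ j k, j ≠ k → b j ≠ 0 ∨ b k ≠ 0) :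
    2 ≤ ∑ j, |b j| := by
  have h01 := hb 0 1 (by decide)
  have h02 := hb 0 2 (by decide)
  have h12 := hb 1 2 (by decide)
  simp only [← abs_pos] at h01 h02 h12
  have := abs_nonneg (b 0)
  have := abs_nonneg (b 1)
  have := abs_nonneg (b 2)
  rw [Fin.sum_univ_three]
  omega


theorem stmt17 (u : Fin 3 → Fin 2 → ℤ)
    -- general linear position: any two of the generators are linearly independent
    (hgen : ∀ j k : Fin 3, j ≠ k → ∀ c₁ c₂ : ℤ,
      (∀ i, c₁ * u j i + c₂ * u k i = 0) → c₁ = 0 ∧ c₂ = 0)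
    (Z : Set (Fin 2 → ℝ))
    (hZ : Z = {x : Fin 2 → ℝ | ∃ t : Fin 3 → ℝ,
      (∀ j, t j ∈ Set.Icc (0 : ℝ) 1) ∧
      x = ∑ j, t j • fun i => (u j i : ℝ)}) :
    -- Z contains an interior lattice point ...
    (∃ z : Fin 2 → ℤ, (fun i => (z i : ℝ)) ∈ interior Z) ∧
    -- ... and consequently has lattice-width at least 2
    (∀ z : Fin 2 → ℤ, z ≠ 0 →
      2 ≤ sSup ((fun x => ∑ i, x i * (z i : ℝ)) '' Z) -
        sInf ((fun x => ∑ i, x i * (z i : ℝ)) '' Z)) := by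
  set L := Fintype.linearCombination ℝ (fun j i => (u j i : ℝ)) with hLdef
  have hL : ∀ t i, L t i = ∑ j, t j * (u j i : ℝ) := fun t i => by
    simp [hLdef, Fintype.linearCombination_apply]
  have hZL : Z = L '' Set.univ.pi fun _ => Set.Icc 0 1 := by
    rw [hZ]
    ext x
    simp only [Set.mem_ofPred_eq, Set.mem_image, Set.mem_univ_pi, hLdef,
      Fintype.linearCombination_apply, eq_comm]
  have hdet : ∀ j k, j ≠ k → u j 0 * u k 1 - u j 1 * u k 0 ≠ 0 := fun j k hjk =>
    det_ne_zero_of_linearly_independent (hgen j k hjk)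
  refine ⟨?_, fun z hz => ?_⟩
  · have hsurj : Function.Surjective L := by
      intro y
      have hd : (u 0 0 * u 1 1 - u 0 1 * u 1 0 : ℝ) ≠ 0 := by
        exact_mod_cast hdet 0 1 (by decide)
      refine ⟨![(y 0 * u 1 1 - y 1 * u 1 0) / (u 0 0 * u 1 1 - u 0 1 * u 1 0),
        (u 0 0 * y 1 - u 0 1 * y 0) / (u 0 0 * u 1 1 - u 0 1 * u 1 0), 0], ?_⟩
      funext i
      rw [hL, Fin.sum_univ_three]
      revert i
      rw [Fin.forall_fin_two]
      constructor <;> simp <;>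
        rw [div_mul_eq_mul_div, div_mul_eq_mul_div, ← add_div, div_eq_iff hd] <;> ring
    let a : Fin 3 → ℤ := ![u 1 0 * u 2 1 - u 1 1 * u 2 0, u 2 0 * u 0 1 - u 2 1 * u 0 0,
      u 0 0 * u 1 1 - u 0 1 * u 1 0]
    have ha : ∀ j, (a j : ℝ) ≠ 0 := by
      intro j
      rw [Int.cast_ne_zero]
      fin_cases j
      · exact hdet 1 2 (by decide)
      · exact hdet 2 0 (by decide)
      · exact hdet 0 1 (by decide)
    have haL : L (fun j => (a j : ℝ)) = 0 := by
      funext i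
      rw [hL, Fin.sum_univ_three]
      revert i
      rw [Fin.forall_fin_two]
      constructor <;> simp [a] <;> ring
    obtain ⟨e, he⟩ := exists_vertex_mem_interior_image_cube L hsurj _ ha haL
    refine ⟨fun i => ∑ j, e j * u j i, ?_⟩
    rw [hZL]
    convert he using 1
    funext i
    rw [hL]
    push_cast
    rfl
  · have himg : (fun x : Fin 2 → ℝ => ∑ i, x i * (z i : ℝ)) '' Z =
        (fun t : Fin 3 → ℝ => ∑ j, t j * ((∑ i, u j i * z i : ℤ) : ℝ)) ''
          Set.univ.pi fun _ => Set.Icc 0 1 := by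
      rw [hZL, Set.image_image]
      refine Set.image_congr fun t _ => ?_
      push_cast
      simp only [hL, Finset.sum_mul, Finset.mul_sum, mul_assoc]
      exact Finset.sum_comm
    rw [himg]
    refine le_trans ?_ (sum_abs_le_sSup_sub_sInf_cube _)
    exact_mod_cast two_le_sum_abs (b := fun j => ∑ i, u j i * z i) fun j k hjk =>
      dot_ne_zero_or_dot_ne_zero (hdet j k hjk) hz
end

section
/- Let v = (v₁, v₂, v₃) ∈ ℤ³ have pairwise distinct positive coordinates with gcd(v₁, v₂, v₃) = 1, let A be a 2×3 integer matrix whose rows form a ℤ-basis of the lattice ℤ³ ∩ v^⊥, and let Z_v = [0,u₁] + [0,u₂] + [0,u₃] ⊆ ℝ² be the zonotope generated by the columns u₁, u₂, u₃ of A. Then the lattice-width of Z_v satisfies w(Z_v) ≥ 3. -/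
/-- An integer vector orthogonal to a positive vector with distinct coordinates has `ℓ¹`-norm at
least `3`, unless it is zero. -/
theorem three_le_sum_abs_of_orthogonal {v w : Fin 3 → ℤ} (hpos : ∀ i, 0 < v i)
    (hinj : Function.Injective v) (hw : w ≠ 0) (horth : ∑ i, w i * v i = 0) :
    3 ≤ ∑ i, |w i| := by
  have h0 := hpos 0
  have h1 := hpos 1
  have h2 := hpos 2
  have h01 : v 0 ≠ v 1 := hinj.ne (by decide)
  have h02 : v 0 ≠ v 2 := hinj.ne (by decide)
  have h12 : v 1 ≠ v 2 := hinj.ne (by decide)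
  by_contra! hlt
  apply hw
  have hext : w 0 = 0 ∧ w 1 = 0 ∧ w 2 = 0 := by
    rw [Fin.sum_univ_three] at horth hlt
    generalize w 0 = a, w 1 = b, w 2 = c at horth hlt ⊢
    have ha : |a| ≤ 2 := by linarith [abs_nonneg b, abs_nonneg c]
    have hb : |b| ≤ 2 := by linarith [abs_nonneg a, abs_nonneg c]
    have hc : |c| ≤ 2 := by linarith [abs_nonneg a, abs_nonneg b]
    obtain ⟨ha, ha'⟩ := abs_le.mp ha
    obtain ⟨hb, hb'⟩ := abs_le.mp hb
    obtain ⟨hc, hc'⟩ := abs_le.mp hc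
    interval_cases a <;> interval_cases b <;> interval_cases c <;>
      first | omega | exact absurd hlt (by decide)
  ext i
  fin_cases i
  exacts [hext.1, hext.2.1, hext.2.2]

/-- A linear form with coefficients `w` has width `∑ |w i|` on the unit cube; here the lower bound,
in terms of the image of the cube. -/
theorem sum_abs_le_sSup_sub_sInf {ι : Type*} [Fintype ι] (w : ι → ℝ) {S : Set ℝ}
    (hS : S = {y | ∃ t : ι → ℝ, (∀ j, t j ∈ Set.Icc (0 : ℝ) 1) ∧ y = ∑ j, t j * w j}) :
    ∑ j, |w j| ≤ sSup S - sInf S := by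
  have hbound : ∀ y ∈ S, |y| ≤ ∑ j, |w j| := by
    rw [hS]
    rintro y ⟨t, ht, rfl⟩
    refine (Finset.abs_sum_le_sum_abs _ _).trans (Finset.sum_le_sum fun j _ => ?_)
    rw [abs_mul, abs_of_nonneg (ht j).1]
    exact mul_le_of_le_one_left (abs_nonneg _) (ht j).2
  have habove : BddAbove S := ⟨_, fun y hy => (abs_le.mp (hbound y hy)).2⟩
  have hbelow : BddBelow S := ⟨_, fun y hy => (abs_le.mp (hbound y hy)).1⟩
  have hmax : ∑ j, (if 0 < w j then 1 else 0) * w j ≤ sSup S := by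
    refine le_csSup habove ?_
    rw [hS]
    exact ⟨fun j => if 0 < w j then 1 else 0, fun j => by dsimp only; split_ifs <;> simp, rfl⟩
  have hmin : sInf S ≤ ∑ j, (if 0 < w j then 0 else 1) * w j := by
    refine csInf_le hbelow ?_
    rw [hS]
    exact ⟨fun j => if 0 < w j then 0 else 1, fun j => by dsimp only; split_ifs <;> simp, rfl⟩
  have hsum : ∑ j, |w j| = ∑ j, (if 0 < w j then 1 else 0) * w j -
      ∑ j, (if 0 < w j then 0 else 1) * w j := by
    rw [← Finset.sum_sub_distrib]
    refine Finset.sum_congr rfl fun j _ => ?_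
    split_ifs with h
    · simp [abs_of_pos h]
    · simp [abs_of_nonpos (not_lt.mp h)]
  linarith

theorem stmt18 (v : Fin 3 → ℤ) (hpos : ∀ i, 0 < v i)
    (hinj : Function.Injective v)
    (hgcd : Finset.univ.gcd v = 1)
    (r : Fin 2 → Fin 3 → ℤ)
    -- the rows `r k` lie in the lattice `ℤ³ ∩ v^⊥` ...
    (horth : ∀ k, ∑ i, r k i * v i = 0)
    -- ... and form a ℤ-basis of it
    (hbasis : ∀ w : Fin 3 → ℤ, (∑ i, w i * v i = 0) →
      ∃! c : Fin 2 → ℤ, w = fun i => ∑ k, c k * r k i)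
    -- the zonotope generated by the columns of the matrix with rows `r k`
    (Z : Set (Fin 2 → ℝ))
    (hZ : Z = {x : Fin 2 → ℝ | ∃ t : Fin 3 → ℝ,
      (∀ j, t j ∈ Set.Icc (0 : ℝ) 1) ∧
      x = ∑ j, t j • fun k => (r k j : ℝ)}) :
    -- the lattice-width of `Z` is at least 3
    ∀ z : Fin 2 → ℤ, z ≠ 0 →
      3 ≤ sSup ((fun x => ∑ i, x i * (z i : ℝ)) '' Z) -
        sInf ((fun x => ∑ i, x i * (z i : ℝ)) '' Z) := by
  intro z hz
  set w : Fin 3 → ℤ := fun i => ∑ k, z k * r k i with hw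
  have hw_orth : ∑ i, w i * v i = 0 := by
    simp only [hw, Finset.sum_mul]
    rw [Finset.sum_comm]
    simp only [mul_assoc, ← Finset.mul_sum, horth, mul_zero, Finset.sum_const_zero]
  have hw_ne : w ≠ 0 := by
    intro h0
    obtain ⟨c, -, hc⟩ := hbasis 0 (by simp)
    exact hz ((hc z h0.symm).trans (hc 0 (by ext i; simp)).symm)
  have hl1 : (3 : ℝ) ≤ ∑ j, |(w j : ℝ)| := by
    exact_mod_cast three_le_sum_abs_of_orthogonal hpos hinj hw_ne hw_orth
  have hform : ∀ t : Fin 3 → ℝ,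
      ∑ i, (∑ j, t j • fun k => (r k j : ℝ)) i * (z i : ℝ) = ∑ j, t j * (w j : ℝ) := by
    intro t
    simp [hw, Fin.sum_univ_three, Fin.sum_univ_two]
    ring
  refine hl1.trans (sum_abs_le_sSup_sub_sInf (fun j => (w j : ℝ)) ?_)
  subst hZ
  ext y
  constructor
  · rintro ⟨x, ⟨t, ht, rfl⟩, rfl⟩
    exact ⟨t, ht, hform t⟩
  · rintro ⟨t, ht, rfl⟩
    exact ⟨_, ⟨t, ht, rfl⟩, hform t⟩
end

section
/- Let v = (v₁, v₂, v₃) ∈ ℤ³ have pairwise distinct positive coordinates with gcd(v₁, v₂, v₃) = 1 and v₁ + v₂ + v₃ ≥ 10, let A be a 2×3 integer matrix whose rows form a ℤ-basis of the lattice ℤ³ ∩ v^⊥, and let Z_v = [0,u₁] + [0,u₂] + [0,u₃] ⊆ ℝ² be the zonotope generated by the columns u₁, u₂, u₃ of A. Then the covering radius of Z_v satisfies μ(Z_v) < 1/2. -/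
open Pointwise

/-- The `2`-periodic square wave equal to `1` on `[0, 1)` and to `-1` on `[1, 2)`. -/
noncomputable def squareWave (x : ℝ) : ℤ := if Even ⌊x⌋ then 1 else -1

theorem squareWave_eq_or (x : ℝ) : squareWave x = 1 ∨ squareWave x = -1 := by
  unfold squareWave; split_ifs <;> simp

theorem squareWave_eq_one_iff {x : ℝ} : squareWave x = 1 ↔ Even ⌊x⌋ := by
  unfold squareWave; split_ifs with h <;> simp [h]

theorem squareWave_congr {x y : ℝ} (h : ⌊x⌋ = ⌊y⌋) : squareWave x = squareWave y := by
  unfold squareWave; rw [h]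

theorem squareWave_add_even (x : ℝ) {n : ℤ} (hn : Even n) :
    squareWave (x + n) = squareWave x := by
  simp [squareWave, Int.even_add, hn]

theorem squareWave_add_odd (x : ℝ) {n : ℤ} (hn : Odd n) :
    squareWave (x + n) = -squareWave x := by
  have hn' : ¬ Even n := by simpa using hn
  by_cases h : Even ⌊x⌋ <;> simp only [squareWave, Int.floor_add_intCast, Int.even_add, h, hn'] <;>
    simp

theorem sum_range_add_of_periodic (f : ℕ → ℤ) (b : ℕ) (hf : ∀ l, f (l + b) = f l) (u : ℕ) :
    ∑ l ∈ Finset.range b, f (l + u) = ∑ l ∈ Finset.range b, f l := by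
  induction u with
  | zero => simp
  | succ u ih =>
    rw [← ih]
    have h1 := Finset.sum_range_succ (fun l => f (l + u)) b
    have h2 := Finset.sum_range_succ' (fun l => f (l + u)) b
    have h3 : f (b + u) = f (0 + u) := by rw [add_comm b u, hf]; simp
    have h4 : ∀ l, f (l + 1 + u) = f (l + (u + 1)) := fun l => by congr 1; ring
    simp only [h4] at h2
    linarith

theorem exists_dvd_mul_sub {a b : ℤ} (hb : 0 < b) (h : IsCoprime a b) (n : ℤ) :
    ∃ u : ℕ, b ∣ a * u - n := by
  obtain ⟨s, t, hst⟩ := h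
  refine ⟨((s * n) % b).toNat, ?_⟩
  rw [Int.toNat_of_nonneg (Int.emod_nonneg _ hb.ne')]
  refine ⟨-(a * (s * n / b)) - t * n, ?_⟩
  have := Int.emod_add_mul_ediv (s * n) b
  linear_combination a * this + n * hst

/-- A square wave sampled at an odd number of equispaced points of its period is balanced. -/
theorem abs_sum_squareWave_le (x : ℝ) {a : ℤ} {b : ℕ} (hb : Odd b) (h : IsCoprime a (b : ℤ)) :
    |∑ l ∈ Finset.range b, squareWave (x + 2 * a * l / b)| ≤ 1 := by
  have hb0 : 0 < b := hb.pos
  have hbR : (0 : ℝ) < b := by exact_mod_cast hb0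
  obtain ⟨m, hm⟩ := hb
  obtain ⟨u, k, hk⟩ := exists_dvd_mul_sub (by exact_mod_cast hb0) h (m + 1)
  have hkR : (a : ℝ) * u = b * k + m + 1 := by
    have : a * u = b * k + m + 1 := by linarith
    exact_mod_cast this
  have hmR : (b : ℝ) = 2 * m + 1 := by exact_mod_cast hm
  have hshift : ∀ l : ℕ, squareWave (x + 2 * a * (l + u : ℕ) / b)
      = -squareWave (x + 2 * a * l / b + 1 / b) := by
    intro l
    rw [← squareWave_add_odd _ (n := 2 * k + 1) ⟨k, rfl⟩]
    congr 1
    push_cast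
    field_simp
    linear_combination 2 * hkR - hmR
  have hper := sum_range_add_of_periodic (fun l : ℕ => squareWave (x + 2 * a * l / b)) b (by
    intro l
    rw [← squareWave_add_even (x + 2 * a * l / b) (n := 2 * a) ⟨a, by ring⟩]
    congr 1
    push_cast
    field_simp
    ring) u
  simp only [hshift, Finset.sum_neg_distrib] at hper
  have hterm : ∀ l ∈ Finset.range b,
      |squareWave (x + 2 * a * l / b) - squareWave (x + 2 * a * l / b + 1 / b)| ≤
        if ⌊x + 2 * a * l / b⌋ = ⌊x + 2 * a * l / b + 1 / b⌋ then 0 else 2 := by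
    intro l _
    split_ifs with hl
    · simp [squareWave_congr hl]
    · rcases squareWave_eq_or (x + 2 * a * l / b) with h1 | h1 <;>
      rcases squareWave_eq_or (x + 2 * a * l / b + 1 / b) with h2 | h2 <;>
      rw [h1, h2] <;> norm_num
  have hcard : (Finset.range b |>.filter fun l : ℕ =>
      ¬ ⌊x + 2 * a * l / b⌋ = ⌊x + 2 * a * l / b + 1 / b⌋).card ≤ 1 := by
    have key : ∀ y : ℝ, ¬ ⌊y⌋ = ⌊y + 1 / b⌋ → (⌊y⌋ : ℝ) + 1 ≤ y + 1 / b := by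
      intro y hy
      by_contra! hlt
      apply hy
      symm
      rw [Int.floor_eq_iff]
      refine ⟨?_, hlt⟩
      have := Int.floor_le y
      have : (0 : ℝ) < 1 / b := by positivity
      linarith
    rw [Finset.card_le_one]
    intro l hl l' hl'
    rw [Finset.mem_filter, Finset.mem_range] at hl hl'
    have h1 := key _ hl.2
    have h2 := key _ hl'.2
    have h3 := Int.lt_floor_add_one (x + 2 * a * l / b)
    have h4 := Int.lt_floor_add_one (x + 2 * a * l' / b)
    set A := ⌊x + 2 * a * l / b⌋
    set B := ⌊x + 2 * a * l' / b⌋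
    have e : ∀ j : ℕ, (x + 2 * a * j / b) * b = x * b + 2 * a * j := by
      intro j; field_simp
    have e' : ∀ j : ℕ, (x + 2 * a * j / b + 1 / b) * b = x * b + 2 * a * j + 1 := by
      intro j; field_simp
    have h1 := mul_le_mul_of_nonneg_right h1 hbR.le
    have h2 := mul_le_mul_of_nonneg_right h2 hbR.le
    have h3 := mul_lt_mul_of_pos_right h3 hbR
    have h4 := mul_lt_mul_of_pos_right h4 hbR
    rw [e'] at h1 h2
    rw [e] at h3 h4
    have i1 : ((2 * a * (l - l') - (A - B) * b : ℤ) : ℝ) < 1 := by push_cast; linarith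
    have i2 : ((-1 : ℤ) : ℝ) < ((2 * a * (l - l') - (A - B) * b : ℤ) : ℝ) := by
      push_cast; linarith
    have i1' : 2 * a * (l - l') - (A - B) * b < (1 : ℤ) := by exact_mod_cast i1
    have i2' : -1 < 2 * a * (l - l') - (A - B) * (b : ℤ) := by exact_mod_cast i2
    have i3 : (a * 2) * (l - l') = (A - B) * (b : ℤ) := by
      have : 2 * a * (l - l') - (A - B) * (b : ℤ) = 0 := by omega
      linear_combination this
    have hc2 : IsCoprime (2 : ℤ) (b : ℤ) := ⟨-m, 1, by rw [hm]; push_cast; ring⟩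
    have hd : (b : ℤ) ∣ l - l' :=
      (IsCoprime.mul_left h hc2).symm.dvd_of_dvd_mul_left ⟨A - B, by rw [i3]; ring⟩
    have := Int.eq_zero_of_abs_lt_dvd hd (by rw [abs_lt]; omega)
    omega
  have h2 : |∑ l ∈ Finset.range b,
      (squareWave (x + 2 * a * l / b) - squareWave (x + 2 * a * l / b + 1 / b))| ≤ 2 := by
    refine (Finset.abs_sum_le_sum_abs _ _).trans ((Finset.sum_le_sum hterm).trans ?_)
    rw [Finset.sum_ite]
    simp only [Finset.sum_const, nsmul_eq_mul]
    have : (((Finset.range b |>.filter fun l : ℕ =>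
      ¬ ⌊x + 2 * a * l / b⌋ = ⌊x + 2 * a * l / b + 1 / b⌋).card : ℕ) : ℤ) ≤ 1 := by exact_mod_cast hcard
    linarith
  rw [Finset.sum_sub_distrib] at h2
  rw [abs_le] at h2 ⊢
  constructor <;> linarith [h2.1, h2.2]

theorem exists_squareWave_eq (x : ℝ) {a b : ℤ} (hb : Odd b) (hb3 : 3 ≤ b) (h : IsCoprime a b)
    {e : ℤ} (he : e = 1 ∨ e = -1) : ∃ l : ℤ, squareWave (x + 2 * a * l / b) = e := by
  lift b to ℕ using by omega
  by_contra! H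
  have hs := abs_sum_squareWave_le x (by exact_mod_cast hb) h
  rw [Finset.sum_congr rfl (g := fun _ => -e) (by
    intro l _
    have h1 := H l
    push_cast at h1
    rcases squareWave_eq_or (x + 2 * a * l / b) with h2 | h2 <;> rcases he with rfl | rfl <;>
      simp_all)] at hs
  simp only [Finset.sum_const, Finset.card_range, nsmul_eq_mul] at hs
  rw [abs_le] at hs
  rcases he with rfl | rfl <;> omega

/-- Two square waves of distinct frequencies are simultaneously positive at some time. -/
theorem exists_two_of_coprime (x y : ℝ) {a b : ℤ} (ha : 0 < a) (hb : 0 < b) (hab : a ≠ b)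
    (h : IsCoprime a b) : ∃ T : ℝ, squareWave (x + a * T) = 1 ∧ squareWave (y + b * T) = 1 := by
  wlog hlt : a < b generalizing x y a b
  · obtain ⟨T, h1, h2⟩ := this y x hb ha hab.symm h.symm (by omega)
    exact ⟨T, h2, h1⟩
  have haR : (a : ℝ) ≠ 0 := by exact_mod_cast ha.ne'
  have hbR : (b : ℝ) ≠ 0 := by exact_mod_cast hb.ne'
  have add1 : ∀ (w : ℝ) (c : ℤ) (T : ℝ), w + c * (T + 1) = w + c * T + c := by intros; ring
  rcases Int.even_or_odd a with pa | pa <;> rcases Int.even_or_odd b with pb | pb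
  · exfalso
    have := h.isUnit_of_dvd' pa.two_dvd pb.two_dvd
    rw [Int.isUnit_iff] at this
    omega
  · have h0 : squareWave (x + a * (-x / a)) = 1 := by
      rw [show x + a * (-x / a) = 0 by field_simp; ring]; simp [squareWave]
    rcases squareWave_eq_or (y + b * (-x / a)) with h1 | h1
    · exact ⟨_, h0, h1⟩
    · refine ⟨-x / a + 1, ?_, ?_⟩
      · rw [add1, squareWave_add_even _ pa, h0]
      · rw [add1, squareWave_add_odd _ pb, h1]; rfl
  · have h0 : squareWave (y + b * (-y / b)) = 1 := by
      rw [show y + b * (-y / b) = 0 by field_simp; ring]; simp [squareWave]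
    rcases squareWave_eq_or (x + a * (-y / b)) with h1 | h1
    · exact ⟨_, h1, h0⟩
    · refine ⟨-y / b + 1, ?_, ?_⟩
      · rw [add1, squareWave_add_odd _ pa, h1]; rfl
      · rw [add1, squareWave_add_even _ pb, h0]
  · obtain ⟨l, hl⟩ := exists_squareWave_eq x pb (by obtain ⟨k, rfl⟩ := pb; omega) h
      (squareWave_eq_or y)
    have h1 : squareWave (x + a * (2 * l / b)) = squareWave y := by
      rw [← hl]; congr 1; ring
    have h2 : squareWave (y + b * (2 * l / b)) = squareWave y := by
      rw [← squareWave_add_even y (n := 2 * l) ⟨l, by ring⟩]; congr 1; push_cast; field_simp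
    rcases squareWave_eq_or y with hy | hy
    · exact ⟨_, h1.trans hy, h2.trans hy⟩
    · refine ⟨2 * l / b + 1, ?_, ?_⟩
      · rw [add1, squareWave_add_odd _ pa, h1, hy]; rfl
      · rw [add1, squareWave_add_odd _ pb, h2, hy]; rfl

theorem exists_two (x y : ℝ) {a b : ℤ} (ha : 0 < a) (hb : 0 < b) (hab : a ≠ b) :
    ∃ T : ℝ, squareWave (x + a * T) = 1 ∧ squareWave (y + b * T) = 1 := by
  obtain ⟨a', ha'⟩ := Int.gcd_dvd_left a b
  obtain ⟨b', hb'⟩ := Int.gcd_dvd_right a b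
  have hg : 0 < (a.gcd b : ℤ) := by exact_mod_cast Int.gcd_pos_of_ne_zero_left b ha.ne'
  set g : ℤ := (a.gcd b : ℤ)
  have hco : IsCoprime a' b' := by
    refine ⟨a.gcdA b, a.gcdB b, ?_⟩
    apply mul_left_cancel₀ hg.ne'
    have := Int.gcd_eq_gcd_ab a b
    calc g * (a.gcdA b * a' + a.gcdB b * b') = g * a' * a.gcdA b + g * b' * a.gcdB b := by ring
      _ = g * 1 := by rw [← ha', ← hb', ← this, mul_one]
  have hgR : (g : ℝ) ≠ 0 := by exact_mod_cast hg.ne'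
  obtain ⟨T, h1, h2⟩ := exists_two_of_coprime x y (a := a') (b := b')
    (pos_of_mul_pos_right (ha' ▸ ha) hg.le) (pos_of_mul_pos_right (hb' ▸ hb) hg.le)
    (by rintro rfl; exact hab (ha'.trans hb'.symm)) hco
  refine ⟨T / g, ?_, ?_⟩
  · rw [← h1, ha']; congr 1; push_cast; field_simp
  · rw [← h2, hb']; congr 1; push_cast; field_simp

theorem exists_three_of_common_divisor (x y z : ℝ) {a b c g : ℤ} (ha : 0 < a) (hb : 0 < b)
    (hab : a ≠ b) (hg : Odd g) (hg3 : 3 ≤ g) (hga : g ∣ a) (hgb : g ∣ b) (hgc : IsCoprime c g) :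
    ∃ T : ℝ, squareWave (x + a * T) = 1 ∧ squareWave (y + b * T) = 1 ∧
      squareWave (z + c * T) = 1 := by
  obtain ⟨T, h1, h2⟩ := exists_two x y ha hb hab
  obtain ⟨l, hl⟩ := exists_squareWave_eq (z + c * T) hg hg3 hgc (Or.inl rfl)
  have hgR : (g : ℝ) ≠ 0 := by
    have : g ≠ 0 := by omega
    exact_mod_cast this
  obtain ⟨a', rfl⟩ := hga
  obtain ⟨b', rfl⟩ := hgb
  refine ⟨T + 2 * l / g, ?_, ?_, ?_⟩
  · rw [← h1, ← squareWave_add_even (x + (g * a' : ℤ) * T) (n := 2 * (l * a')) ⟨l * a', by ring⟩]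
    congr 1; push_cast; field_simp; ring
  · rw [← h2, ← squareWave_add_even (y + (g * b' : ℤ) * T) (n := 2 * (l * b')) ⟨l * b', by ring⟩]
    congr 1; push_cast; field_simp; ring
  · rw [← hl]; congr 1; ring

theorem exists_three_of_odd (x y z : ℝ) {a b c : ℤ} (ha5 : 5 ≤ a) (hb3 : 3 ≤ b)
    (pa : Odd a) (pb : Odd b) (pc : Odd c)
    (hab : IsCoprime a b) (hac : IsCoprime a c) (hbc : IsCoprime b c) :
    ∃ T : ℝ, squareWave (x + a * T) = 1 ∧ squareWave (y + b * T) = 1 ∧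
      squareWave (z + c * T) = 1 := by
  by_contra! H
  have add1 : ∀ (w : ℝ) (c : ℤ) (T : ℝ), w + c * (T + 1) = w + c * T + c := by intros; ring
  have hpt : ∀ T : ℝ, squareWave (x + a * T) * (squareWave (y + b * T) + squareWave (z + c * T))
      + squareWave (y + b * T) * squareWave (z + c * T) = -1 := by
    intro T
    have h1 := H T
    have h2 := H (T + 1)
    rw [add1, add1, add1, squareWave_add_odd _ pa, squareWave_add_odd _ pb,
      squareWave_add_odd _ pc] at h2
    rcases squareWave_eq_or (x + a * T) with e1 | e1 <;>
    rcases squareWave_eq_or (y + b * T) with e2 | e2 <;>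
    rcases squareWave_eq_or (z + c * T) with e3 | e3 <;>
    simp_all
  lift a to ℕ using by omega
  lift b to ℕ using by omega
  have haR : (a : ℝ) ≠ 0 := by
    have : a ≠ 0 := by omega
    exact_mod_cast this
  have hbR : (b : ℝ) ≠ 0 := by
    have : b ≠ 0 := by omega
    exact_mod_cast this
  push_cast at hpt
  have hrow : ∀ T : ℝ, ∑ l ∈ Finset.range a, squareWave (y + b * (T + 2 * l / a)) *
      squareWave (z + c * (T + 2 * l / a)) ≤ 2 - a := by
    intro T
    have hx : ∀ l : ℕ, squareWave (x + a * (T + 2 * l / a)) = squareWave (x + a * T) := by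
      intro l
      rw [← squareWave_add_even (x + a * T) (n := 2 * l) ⟨l, by ring⟩]
      congr 1; push_cast; field_simp; ring
    have hsum := Finset.sum_congr (rfl : Finset.range a = _)
      fun (l : ℕ) _ => hpt (T + 2 * l / a)
    simp only [hx, Finset.sum_add_distrib, ← Finset.mul_sum, Finset.sum_const, Finset.card_range,
      nsmul_eq_mul] at hsum
    have hy := abs_sum_squareWave_le (y + b * T) (by exact_mod_cast pa) hab.symm
    have hz := abs_sum_squareWave_le (z + c * T) (by exact_mod_cast pa) hac.symm
    have ey : ∀ l : ℕ, y + b * T + 2 * (b : ℤ) * l / a = y + b * (T + 2 * l / a) := by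
      intro l; push_cast; ring
    have ez : ∀ l : ℕ, z + c * T + 2 * c * l / a = z + c * (T + 2 * l / a) := by
      intro l; ring
    simp only [ey] at hy
    simp only [ez] at hz
    rw [abs_le] at hy hz
    rcases squareWave_eq_or (x + a * T) with e1 | e1 <;> rw [e1] at hsum <;> linarith
  have hcol : ∀ T : ℝ, -1 ≤ ∑ j ∈ Finset.range b, squareWave (y + b * (2 * j / b + T)) *
      squareWave (z + c * (2 * j / b + T)) := by
    intro T
    have hy : ∀ j : ℕ, squareWave (y + b * (2 * j / b + T)) = squareWave (y + b * T) := by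
      intro j
      rw [← squareWave_add_even (y + b * T) (n := 2 * j) ⟨j, by ring⟩]
      congr 1; push_cast; field_simp; ring
    simp only [hy, ← Finset.mul_sum]
    have hz := abs_sum_squareWave_le (z + c * T) (by exact_mod_cast pb) hbc.symm
    have ez : ∀ j : ℕ, z + c * T + 2 * c * j / b = z + c * (2 * j / b + T) := by
      intro j; ring
    simp only [ez] at hz
    rw [abs_le] at hz
    rcases squareWave_eq_or (y + b * T) with e1 | e1 <;> rw [e1] <;> linarith
  have h1 := Finset.sum_le_sum fun (j : ℕ) (_ : j ∈ Finset.range b) => hrow (2 * j / b)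
  have h2 := Finset.sum_le_sum fun (l : ℕ) (_ : l ∈ Finset.range a) => hcol (2 * l / a)
  rw [Finset.sum_comm] at h2
  have h3 := h2.trans h1
  simp only [Finset.sum_const, Finset.card_range, nsmul_eq_mul] at h3
  nlinarith

/-- A zero of one wave inside a positive arc of the even wave has to be a zero of the other. -/
theorem exists_int_eq_of_crossing {x y z : ℝ} {p q w : ℤ} (hp : 0 < p) (hq : 0 < q) (hw : 0 < w)
    (H : ∀ T : ℝ, squareWave (z + w * T) = 1 →
      squareWave (x + p * T) ≠ squareWave (y + q * T))
    {T : ℝ} {n : ℤ} (hn : x + p * T = n) (hz : squareWave (z + w * T) = 1)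
    (hz0 : 0 < Int.fract (z + w * T)) : ∃ k : ℤ, y + q * T = k := by
  by_contra! hk
  have hy0 : 0 < Int.fract (y + q * T) := by
    refine lt_of_le_of_ne (Int.fract_nonneg _) fun h => hk ⌊y + q * T⌋ ?_
    have := Int.floor_add_fract (y + q * T)
    rw [← h] at this
    linarith
  have hpR : (0 : ℝ) < p := by exact_mod_cast hp
  have hqR : (0 : ℝ) < q := by exact_mod_cast hq
  have hwR : (0 : ℝ) < w := by exact_mod_cast hw
  obtain ⟨ε, hε, h1, h2, h3⟩ : ∃ ε : ℝ, 0 < ε ∧ w * ε ≤ Int.fract (z + w * T) ∧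
      q * ε ≤ Int.fract (y + q * T) ∧ p * ε ≤ 1 := by
    refine ⟨min (Int.fract (z + w * T) / w) (min (Int.fract (y + q * T) / q) (1 / p)),
      by positivity, ?_, ?_, ?_⟩
    · rw [mul_comm, ← le_div_iff₀ hwR]; exact min_le_left _ _
    · rw [mul_comm, ← le_div_iff₀ hqR]; exact (min_le_right _ _).trans (min_le_left _ _)
    · rw [mul_comm, ← le_div_iff₀ hpR]; exact (min_le_right _ _).trans (min_le_right _ _)
  have hleft : ∀ (s : ℝ) (v : ℤ), 0 < (v : ℝ) → v * ε ≤ Int.fract (s + v * T) →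
      squareWave (s + v * (T - ε)) = squareWave (s + v * T) := by
    intro s v hv hf
    apply squareWave_congr
    rw [Int.floor_eq_iff]
    have e1 := Int.floor_add_fract (s + v * T)
    have e2 := Int.lt_floor_add_one (s + v * T)
    have e3 := mul_pos hv hε
    constructor <;> linarith
  have hx : squareWave (x + p * (T - ε)) = -squareWave (x + p * T) := by
    rw [← squareWave_add_odd (x + p * T) (n := -1) (by decide)]
    apply squareWave_congr
    have e3 := mul_pos hpR hε
    rw [hn, ← Int.cast_add, Int.floor_intCast, Int.floor_eq_iff]
    push_cast
    constructor <;> linarith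
  have H1 := H T hz
  have H2 := H (T - ε) ((hleft z w hwR h1).trans hz)
  rw [hx, hleft y q hqR h2] at H2
  rcases squareWave_eq_or (x + p * T) with e1 | e1 <;>
  rcases squareWave_eq_or (y + q * T) with e2 | e2 <;> simp_all

/-- The phases of a wave of frequency `2 * m` at the zeros of a wave of frequency `p` run, modulo
the period, through all translates by multiples of `2 / p`. -/
theorem exists_zero_with_phase (x z : ℝ) {p m : ℤ} (hp : 0 < p) (h : IsCoprime m p) (n : ℤ) :
    ∃ k : ℤ, p ∣ m * k - n ∧ ∃ j : ℤ, z + (2 * m : ℤ) * ((k - x) / p) =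
      z - 2 * m * x / p + 2 * n / p + (2 * j : ℤ) := by
  obtain ⟨u, j, hj⟩ := exists_dvd_mul_sub hp h n
  refine ⟨u, ⟨j, hj⟩, j, ?_⟩
  have hpR : (p : ℝ) ≠ 0 := by exact_mod_cast hp.ne'
  have hjR : (m : ℝ) * u - n = p * j := by exact_mod_cast hj
  push_cast
  field_simp
  linear_combination 2 * hjR

theorem exists_small_phase (s : ℝ) {p : ℤ} (hp : 0 < p) :
    ∃ n : ℤ, 0 < s + 2 * n / p ∧ s + 2 * n / p ≤ 2 / p := by
  have hpR : (0 : ℝ) < p := by exact_mod_cast hp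
  refine ⟨⌊-(p * s / 2)⌋ + 1, ?_, ?_⟩
  · have := Int.lt_floor_add_one (-(p * s / 2))
    rw [← mul_pos_iff_of_pos_right hpR, add_mul, div_mul_cancel₀ _ hpR.ne']
    push_cast
    linarith
  · have := Int.floor_le (-(p * s / 2))
    rw [le_div_iff₀ hpR, add_mul, div_mul_cancel₀ _ hpR.ne']
    push_cast
    linarith

theorem squareWave_of_phase {t s : ℝ} {j : ℤ} (ht : t = s + (2 * j : ℤ)) (h0 : 0 < s)
    (h1 : s < 1) : squareWave t = 1 ∧ 0 < Int.fract t := by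
  subst ht
  refine ⟨?_, ?_⟩
  · rw [squareWave_add_even _ ⟨j, by ring⟩, squareWave_eq_one_iff,
      Int.floor_eq_zero_iff.2 ⟨h0.le, h1⟩]
    exact Even.zero
  · rw [Int.fract_add_intCast, Int.fract_eq_self.2 ⟨h0.le, h1⟩]
    exact h0

theorem exists_pos_and_eq_of_five_le {x y z : ℝ} {p q m : ℤ} (hp : 5 ≤ p) (hq : 0 < q) (hm : 0 < m)
    (hpq : IsCoprime p q) (hmp : IsCoprime m p) :
    ∃ T : ℝ, squareWave (z + (2 * m : ℤ) * T) = 1 ∧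
      squareWave (x + p * T) = squareWave (y + q * T) := by
  by_contra! H
  have hp0 : 0 < p := by omega
  have hpR : (0 : ℝ) < p := by exact_mod_cast hp0
  have hp5 : (5 : ℝ) ≤ p := by exact_mod_cast hp
  obtain ⟨n, hn0, hn1⟩ := exists_small_phase (z - 2 * m * x / p) hp0
  have h4 : 4 / (p : ℝ) < 1 := by rw [div_lt_one hpR]; linarith
  have h2 : 0 < 2 / (p : ℝ) := by positivity
  have h22 : 4 / (p : ℝ) = 2 / p + 2 / p := by ring
  have key : ∀ n' : ℤ, 0 < z - 2 * m * x / p + 2 * n' / p → z - 2 * m * x / p + 2 * n' / p < 1 →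
      ∃ k : ℤ, p ∣ m * k - n' ∧ ∃ i : ℤ, y + q * ((k - x) / p) = i := by
    intro n' h0 h1
    obtain ⟨k, hk, j, hj⟩ := exists_zero_with_phase x z hp0 hmp n'
    obtain ⟨e1, e2⟩ := squareWave_of_phase hj h0 h1
    refine ⟨k, hk, exists_int_eq_of_crossing hp0 hq (by omega) H (n := k) ?_ e1 e2⟩
    field_simp
    ring
  obtain ⟨k, hk, i, hi⟩ := key n hn0 (by linarith)
  have hstep : 2 * ((n + 1 : ℤ) : ℝ) / p = 2 * n / p + 2 / p := by push_cast; ring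
  obtain ⟨k', hk', i', hi'⟩ := key (n + 1) (by rw [hstep]; linarith) (by rw [hstep]; linarith)
  have hdR : (q : ℝ) * (k' - k) = p * (i' - i) := by
    rw [← hi, ← hi']
    field_simp
    ring
  have hd : p ∣ q * (k' - k) := ⟨i' - i, by exact_mod_cast hdR⟩
  have hd' : p ∣ m * (k' - k) := (hpq.dvd_of_dvd_mul_left hd).mul_left m
  have h1 : p ∣ 1 := by
    have := (hd'.sub hk').add hk
    ring_nf at this
    simpa using this
  exact absurd (Int.le_of_dvd one_pos h1) (by omega)

theorem exists_pos_and_eq_of_three_one {x y z : ℝ} {m : ℤ} (hm : 2 ≤ m) (hmp : IsCoprime m 3) :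
    ∃ T : ℝ, squareWave (z + (2 * m : ℤ) * T) = 1 ∧
      squareWave (x + (3 : ℤ) * T) = squareWave (y + (1 : ℤ) * T) := by
  by_contra! H
  obtain ⟨n, hn0, hn1⟩ := exists_small_phase (z - 2 * m * x / (3 : ℤ)) (p := 3) (by norm_num)
  obtain ⟨k, -, j, hj⟩ := exists_zero_with_phase x z (p := 3) (by norm_num) hmp n
  obtain ⟨e1, e2⟩ := squareWave_of_phase hj hn0 (by push_cast at *; linarith)
  obtain ⟨i, hi⟩ := exists_int_eq_of_crossing (by norm_num) (by norm_num) (by omega) H (n := k)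
    (by push_cast; ring) e1 e2
  set T : ℝ := (k - x) / (3 : ℤ) with hT
  have hx : x + (3 : ℤ) * T = k := by rw [hT]; push_cast; ring
  have hmR : (2 : ℝ) ≤ m := by exact_mod_cast hm
  set δ : ℝ := 1 / (2 * m) with hδ
  have hδ0 : 0 < δ := by positivity
  have hδ1 : δ ≤ 1 / 4 := by
    rw [hδ]; apply one_div_le_one_div_of_le <;> linarith
  have hstep : ∀ τ : ℝ, squareWave (z + (2 * m : ℤ) * (τ + δ)) =
      -squareWave (z + (2 * m : ℤ) * τ) := by
    intro τ
    rw [← squareWave_add_odd _ (n := 1) odd_one]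
    congr 1
    rw [hδ]; push_cast; field_simp; ring
  have hvx : ∀ (r : ℤ) (t : ℝ), (r : ℝ) ≤ 3 * t → 3 * t < r + 1 →
      squareWave (x + (3 : ℤ) * (T + t)) = squareWave ((k + r : ℤ) : ℝ) := by
    intro r t h1 h2
    apply squareWave_congr
    rw [Int.floor_intCast, Int.floor_eq_iff, mul_add, ← add_assoc, hx]
    push_cast
    constructor <;> linarith
  have hvy : ∀ t : ℝ, 0 ≤ t → t < 1 →
      squareWave (y + (1 : ℤ) * (T + t)) = squareWave (i : ℝ) := by
    intro t h1 h2
    apply squareWave_congr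
    rw [Int.floor_intCast, Int.floor_eq_iff, mul_add, ← add_assoc, hi]
    push_cast
    constructor <;> linarith
  have hneg : ∀ (r : ℤ), 0 ≤ r → r ≤ 1 → squareWave ((k + r : ℤ) : ℝ) ≠ squareWave (i : ℝ) := by
    intro r h0 h1 heq
    have h0R : (0 : ℝ) ≤ r := by exact_mod_cast h0
    have h1R : (r : ℝ) ≤ 1 := by exact_mod_cast h1
    have A := H (T + r / 3)
    have B := H (T + (r / 3 + δ))
    rw [hvx r _ (by linarith) (by linarith), hvy _ (by linarith) (by linarith)] at A B
    rw [← add_assoc, hstep] at B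
    rcases squareWave_eq_or (z + (2 * m : ℤ) * (T + r / 3)) with e | e
    · exact A e heq
    · exact B (by rw [e]; rfl) heq
  have A := hneg 0 le_rfl zero_le_one
  have B := hneg 1 zero_le_one le_rfl
  rw [add_zero] at A
  rw [Int.cast_add, squareWave_add_odd _ odd_one] at B
  rcases squareWave_eq_or (k : ℝ) with c1 | c1 <;> rcases squareWave_eq_or (i : ℝ) with c2 | c2 <;>
  simp_all

theorem exists_three_of_even (x y z : ℝ) {a b c : ℤ} (ha : 0 < a) (hb : 0 < b) (hc : 0 < c)
    (hne : a ≠ b) (hsum : 10 ≤ a + b + c) (pa : Odd a) (pb : Odd b) (pc : Even c)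
    (hab : IsCoprime a b) (hac : IsCoprime a c) (hbc : IsCoprime b c) :
    ∃ T : ℝ, squareWave (x + a * T) = 1 ∧ squareWave (y + b * T) = 1 ∧
      squareWave (z + c * T) = 1 := by
  wlog hlt : b < a generalizing x y a b
  · obtain ⟨T, h1, h2, h3⟩ := this y x hb ha hne.symm (by omega) pb pa hab.symm hbc hac (by omega)
    exact ⟨T, h2, h1, h3⟩
  have pc' := pc
  obtain ⟨m, hm⟩ := pc'
  rw [← two_mul] at hm
  have hma : IsCoprime m a := (hm ▸ hac).of_mul_right_right.symm
  suffices h : ∃ T : ℝ, squareWave (z + c * T) = 1 ∧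
      squareWave (x + a * T) = squareWave (y + b * T) by
    obtain ⟨T, h1, h2⟩ := h
    rcases squareWave_eq_or (x + a * T) with e | e
    · exact ⟨T, e, by rw [← h2, e], h1⟩
    · refine ⟨T + 1, ?_, ?_, ?_⟩
      · rw [mul_add, mul_one, ← add_assoc, squareWave_add_odd _ pa, e]; rfl
      · rw [mul_add, mul_one, ← add_assoc, squareWave_add_odd _ pb, ← h2, e]; rfl
      · rw [mul_add, mul_one, ← add_assoc, squareWave_add_even _ pc, h1]
  subst hm
  by_cases h5 : 5 ≤ a
  · exact exists_pos_and_eq_of_five_le h5 hb (by omega) hab hma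
  · obtain ⟨s, rfl⟩ := pa
    obtain ⟨t, rfl⟩ := pb
    obtain rfl : s = 1 := by omega
    obtain rfl : t = 0 := by omega
    exact exists_pos_and_eq_of_three_one (by omega) hma

theorem isCoprime_or_exists_three (x y z : ℝ) {a b c : ℤ} (ha : 0 < a) (hb : 0 < b) (hab : a ≠ b)
    (hgcd : ∀ d : ℤ, d ∣ a → d ∣ b → d ∣ c → IsUnit d) (hodd : Odd a ∨ Odd b) :
    IsCoprime a b ∨ ∃ T : ℝ, squareWave (x + a * T) = 1 ∧ squareWave (y + b * T) = 1 ∧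
      squareWave (z + c * T) = 1 := by
  have hg : 0 < (a.gcd b : ℤ) := by exact_mod_cast Int.gcd_pos_of_ne_zero_left b ha.ne'
  have hga : (a.gcd b : ℤ) ∣ a := Int.gcd_dvd_left a b
  have hgb : (a.gcd b : ℤ) ∣ b := Int.gcd_dvd_right a b
  have hgo : Odd (a.gcd b : ℤ) := by
    have hdvd : ∀ n d : ℤ, d ∣ n → Odd n → Odd d := by
      rintro _ d ⟨k, rfl⟩ h
      exact (Int.odd_mul.1 h).1
    exact hodd.elim (hdvd _ _ hga) (hdvd _ _ hgb)
  have hgc : IsCoprime c (a.gcd b : ℤ) := by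
    rw [Int.isCoprime_iff_gcd_eq_one]
    have h1 : ((c.gcd (a.gcd b : ℤ) : ℕ) : ℤ) ∣ (a.gcd b : ℤ) := Int.gcd_dvd_right _ _
    have := hgcd _ (h1.trans hga) (h1.trans hgb) (Int.gcd_dvd_left c (a.gcd b : ℤ))
    rw [Int.isUnit_iff] at this
    omega
  rw [Int.isCoprime_iff_gcd_eq_one]
  by_cases h1 : a.gcd b = 1
  · exact Or.inl h1
  · have hg3 : 3 ≤ (a.gcd b : ℤ) := by
      obtain ⟨k, hk⟩ := hgo
      omega
    exact Or.inr (exists_three_of_common_divisor x y z ha hb hab hgo hg3 hga hgb hgc)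

theorem exists_three_of_two_even (x y z : ℝ) {a b c : ℤ} (hb : 0 < b) (hc : 0 < c)
    (hbc : b ≠ c) (pa : Odd a) (pb : Even b) (pc : Even c) :
    ∃ T : ℝ, squareWave (x + a * T) = 1 ∧ squareWave (y + b * T) = 1 ∧
      squareWave (z + c * T) = 1 := by
  obtain ⟨T, h1, h2⟩ := exists_two y z hb hc hbc
  rcases squareWave_eq_or (x + a * T) with e | e
  · exact ⟨T, e, h1, h2⟩
  · refine ⟨T + 1, ?_, ?_, ?_⟩
    · rw [mul_add, mul_one, ← add_assoc, squareWave_add_odd _ pa, e]; rfl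
    · rw [mul_add, mul_one, ← add_assoc, squareWave_add_even _ pb, h1]
    · rw [mul_add, mul_one, ← add_assoc, squareWave_add_even _ pc, h2]

/-- Three square waves of distinct setwise coprime frequencies, not too small, are simultaneously
positive at some time, whatever their phases. -/
theorem exists_three (x y z : ℝ) {a b c : ℤ} (ha : 0 < a) (hb : 0 < b) (hc : 0 < c)
    (hab : a ≠ b) (hac : a ≠ c) (hbc : b ≠ c) (hsum : 10 ≤ a + b + c)
    (hgcd : ∀ d : ℤ, d ∣ a → d ∣ b → d ∣ c → IsUnit d) :
    ∃ T : ℝ, squareWave (x + a * T) = 1 ∧ squareWave (y + b * T) = 1 ∧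
      squareWave (z + c * T) = 1 := by
  have cop_ab := isCoprime_or_exists_three x y z ha hb hab hgcd
  have cop_ac := isCoprime_or_exists_three x z y ha hc hac fun d h1 h2 h3 => hgcd d h1 h3 h2
  have cop_bc := isCoprime_or_exists_three y z x hb hc hbc fun d h1 h2 h3 => hgcd d h3 h1 h2
  have rot {P Q R : ℝ → Prop} : (∃ T, P T ∧ Q T ∧ R T) → ∃ T, R T ∧ P T ∧ Q T :=
    fun ⟨T, h1, h2, h3⟩ => ⟨T, h3, h1, h2⟩
  have swap {P Q R : ℝ → Prop} : (∃ T, P T ∧ Q T ∧ R T) → ∃ T, P T ∧ R T ∧ Q T :=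
    fun ⟨T, h1, h2, h3⟩ => ⟨T, h1, h3, h2⟩
  rcases Int.even_or_odd a with pa | pa <;> rcases Int.even_or_odd b with pb | pb <;>
  rcases Int.even_or_odd c with pc | pc
  · have := hgcd 2 pa.two_dvd pb.two_dvd pc.two_dvd
    rw [Int.isUnit_iff] at this
    omega
  · exact rot (rot (exists_three_of_two_even z x y ha hb hab pc pa pb))
  · exact rot (swap (exists_three_of_two_even y x z ha hc hac pb pa pc))
  · rcases cop_ab (Or.inr pb) with h1 | h1
    · rcases cop_ac (Or.inr pc) with h2 | h2
      · rcases cop_bc (Or.inr pc) with h3 | h3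
        · exact rot (exists_three_of_even y z x hb hc ha hbc (by omega) pb pc pa h3 h1.symm h2.symm)
        · exact rot h3
      · exact swap h2
    · exact h1
  · exact exists_three_of_two_even x y z hb hc hbc pa pb pc
  · rcases cop_ab (Or.inl pa) with h1 | h1
    · rcases cop_ac (Or.inr pc) with h2 | h2
      · rcases cop_bc (Or.inr pc) with h3 | h3
        · exact swap (exists_three_of_even x z y ha hc hb hac (by omega) pa pc pb h2 h1 h3.symm)
        · exact rot h3
      · exact swap h2
    · exact h1
  · rcases cop_ab (Or.inr pb) with h1 | h1
    · rcases cop_ac (Or.inl pa) with h2 | h2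
      · rcases cop_bc (Or.inl pb) with h3 | h3
        · exact exists_three_of_even x y z ha hb hc hab hsum pa pb pc h1 h2 h3
        · exact rot h3
      · exact swap h2
    · exact h1
  · rcases cop_ab (Or.inr pb) with h1 | h1
    · rcases cop_ac (Or.inl pa) with h2 | h2
      · rcases cop_bc (Or.inl pb) with h3 | h3
        · have hcase : (5 ≤ a ∧ 3 ≤ b) ∨ (5 ≤ a ∧ 3 ≤ c) ∨ (5 ≤ b ∧ 3 ≤ a) ∨ (5 ≤ b ∧ 3 ≤ c) ∨
              (5 ≤ c ∧ 3 ≤ a) ∨ (5 ≤ c ∧ 3 ≤ b) := by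
            obtain ⟨r, hr⟩ := pa
            obtain ⟨s, hs⟩ := pb
            obtain ⟨t, ht⟩ := pc
            omega
          rcases hcase with ⟨k1, k2⟩ | ⟨k1, k2⟩ | ⟨k1, k2⟩ | ⟨k1, k2⟩ | ⟨k1, k2⟩ | ⟨k1, k2⟩
          · exact exists_three_of_odd x y z k1 k2 pa pb pc h1 h2 h3
          · exact swap (exists_three_of_odd x z y k1 k2 pa pc pb h2 h1 h3.symm)
          · exact rot (swap (exists_three_of_odd y x z k1 k2 pb pa pc h1.symm h3 h2))
          · exact rot (exists_three_of_odd y z x k1 k2 pb pc pa h3 h1.symm h2.symm)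
          · exact rot (rot (exists_three_of_odd z x y k1 k2 pc pa pb h2.symm h3.symm h1))
          · exact rot (rot (swap (exists_three_of_odd z y x k1 k2 pc pb pa h3.symm h2.symm h1.symm)))
        · exact rot h3
      · exact swap h2
    · exact h1

theorem exists_time_in_open_box (v : Fin 3 → ℤ) (hpos : ∀ i, 0 < v i)
    (hinj : Function.Injective v) (hgcd : Finset.univ.gcd v = 1) (hsum : 10 ≤ v 0 + v 1 + v 2)
    (s : Fin 3 → ℝ) :
    ∃ (t : ℝ) (w : Fin 3 → ℤ), ∀ i, 0 < s i + t * v i - w i ∧ s i + t * v i - w i < 1 / 2 := by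
  obtain ⟨T, h0, h1, h2⟩ := exists_three (2 * s 0) (2 * s 1) (2 * s 2) (hpos 0) (hpos 1) (hpos 2)
    (hinj.ne (by decide)) (hinj.ne (by decide)) (hinj.ne (by decide)) hsum (by
      intro d hd0 hd1 hd2
      rw [isUnit_iff_dvd_one, ← hgcd]
      refine Finset.dvd_gcd fun i _ => ?_
      fin_cases i <;> assumption)
  have hT : ∀ i, squareWave (2 * s i + v i * T) = 1 := by
    intro i
    fin_cases i <;> assumption
  have hvR : ∀ i, (0 : ℝ) < v i := fun i => by exact_mod_cast hpos i
  have hi : ∀ i, ∃ n : ℤ, ∃ η : ℝ, 0 < η ∧ 2 * n ≤ 2 * s i + v i * T ∧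
      ∀ ε, ε < η → 2 * s i + v i * (T + ε) < 2 * n + 1 := by
    intro i
    obtain ⟨n, hn⟩ := squareWave_eq_one_iff.1 (hT i)
    have e1 := Int.floor_le (2 * s i + v i * T)
    have e2 := Int.lt_floor_add_one (2 * s i + v i * T)
    rw [hn] at e1 e2
    push_cast at e1 e2
    refine ⟨n, (2 * n + 1 - (2 * s i + v i * T)) / v i, div_pos (by linarith) (hvR i),
      by linarith, fun ε hε => ?_⟩
    rw [lt_div_iff₀ (hvR i)] at hε
    linarith
  choose n η hη hle hlt using hi
  obtain ⟨ε, hε0, hε⟩ : ∃ ε > 0, ∀ i, ε < η i := by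
    have hev : ∀ᶠ ε in nhdsWithin (0 : ℝ) (Set.Ioi 0), ∀ i, ε < η i :=
      Filter.eventually_all.2 fun i => nhdsWithin_le_nhds (gt_mem_nhds (hη i))
    obtain ⟨ε, h1, h2⟩ := (hev.and self_mem_nhdsWithin).exists
    exact ⟨ε, h2, h1⟩
  refine ⟨(T + ε) / 2, n, fun i => ?_⟩
  have e1 := hle i
  have e2 := hlt i ε (hε i)
  have e3 := mul_pos (hvR i) hε0
  constructor <;> linarith

theorem exists_uniform_box (v : Fin 3 → ℤ)
    (hbox : ∀ s : Fin 3 → ℝ, ∃ (t : ℝ) (w : Fin 3 → ℤ), ∀ i,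
      0 < s i + t * v i - w i ∧ s i + t * v i - w i < 1 / 2) :
    ∃ μ : ℝ, 0 < μ ∧ μ < 1 / 2 ∧ ∀ s : Fin 3 → ℝ, ∃ (t : ℝ) (w : Fin 3 → ℤ), ∀ i,
      0 ≤ s i + t * v i - w i ∧ s i + t * v i - w i ≤ μ := by
  let U : ℕ → Set (Fin 3 → ℝ) := fun n => ⋃ (t : ℝ) (w : Fin 3 → ℤ),
    ⋂ i, {s | 0 < s i + t * v i - w i ∧ s i + t * v i - w i < 1 / 2 - 1 / (n + 3)}
  have hU : ∀ n, IsOpen (U n) := fun n => isOpen_iUnion fun t => isOpen_iUnion fun w =>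
    isOpen_iInter_of_finite fun i =>
      (isOpen_lt (f := fun _ => (0 : ℝ)) (g := fun s : Fin 3 → ℝ => s i + t * v i - w i)
        (by fun_prop) (by fun_prop)).inter
      (isOpen_lt (f := fun s : Fin 3 → ℝ => s i + t * v i - w i)
        (g := fun _ => (1 / 2 - 1 / (n + 3) : ℝ)) (by fun_prop) (by fun_prop))
  have hmono : Monotone U := by
    intro m n hmn s hs
    simp only [U, Set.mem_iUnion, Set.mem_iInter, Set.mem_ofPred_eq] at hs ⊢
    obtain ⟨t, w, h⟩ := hs
    refine ⟨t, w, fun i => ⟨(h i).1, (h i).2.trans_le ?_⟩⟩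
    have : (m : ℝ) ≤ n := by exact_mod_cast hmn
    have := one_div_le_one_div_of_le (by positivity : (0 : ℝ) < m + 3)
      (by linarith : (m : ℝ) + 3 ≤ n + 3)
    linarith
  have hcov : Set.Icc (0 : Fin 3 → ℝ) 1 ⊆ ⋃ n, U n := by
    intro s _
    obtain ⟨t, w, h⟩ := hbox s
    have hev : ∀ᶠ n : ℕ in Filter.atTop, ∀ i, s i + t * v i - w i < 1 / 2 - 1 / ((n : ℝ) + 3) := by
      refine Filter.eventually_all.2 fun i => ?_
      obtain ⟨N, hN⟩ := exists_nat_one_div_lt (sub_pos.2 (h i).2)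
      filter_upwards [Filter.eventually_ge_atTop N] with n hn
      have : (N : ℝ) ≤ n := by exact_mod_cast hn
      have := one_div_le_one_div_of_le (by positivity : (0 : ℝ) < N + 1)
        (by linarith : (N : ℝ) + 1 ≤ n + 3)
      linarith
    obtain ⟨n, hn⟩ := hev.exists
    simp only [U, Set.mem_iUnion, Set.mem_iInter, Set.mem_ofPred_eq]
    exact ⟨n, t, w, fun i => ⟨(h i).1, hn i⟩⟩
  obtain ⟨n, hn⟩ := isCompact_Icc.elim_directed_cover U hU hcov hmono.directed_le
  refine ⟨1 / 2 - 1 / (n + 3), ?_, ?_, fun s => ?_⟩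
  · have : (1 : ℝ) / (n + 3) ≤ 1 / 3 := one_div_le_one_div_of_le (by norm_num) (by simp)
    linarith
  · have : (0 : ℝ) < 1 / (n + 3) := by positivity
    linarith
  · have hs := @hn (fun i => Int.fract (s i))
      ⟨fun i => Int.fract_nonneg _, fun i => (Int.fract_lt_one _).le⟩
    simp only [U, Set.mem_iUnion, Set.mem_iInter, Set.mem_ofPred_eq] at hs
    obtain ⟨t, w, h⟩ := hs
    refine ⟨t, fun i => ⌊s i⌋ + w i, fun i => ?_⟩
    have := Int.floor_add_fract (s i)
    push_cast
    constructor <;> linarith [(h i).1, (h i).2]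

/-- Two integer vectors in `ℤ³` that are linearly independent over `ℤ` span a plane over `ℝ`,
so that the transposed map `ℝ³ → ℝ²` is onto. -/
theorem exists_real_preimage (r : Fin 2 → Fin 3 → ℤ)
    (hind : ∀ c : Fin 2 → ℤ, (∀ i, ∑ k, c k * r k i = 0) → c = 0) (x : Fin 2 → ℝ) :
    ∃ s : Fin 3 → ℝ, ∀ k, ∑ j, s j * r k j = x k := by
  obtain ⟨i, j, hD⟩ : ∃ i j, r 0 i * r 1 j - r 0 j * r 1 i ≠ 0 := by
    by_contra! H
    have h0 : ∀ j, r 0 j = 0 ∧ r 1 j = 0 := by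
      intro j
      have := hind ![r 1 j, -r 0 j] fun i => by
        simp only [Fin.sum_univ_two, Matrix.cons_val_zero, Matrix.cons_val_one]
        linear_combination H i j
      have e0 := congrFun this 0
      have e1 := congrFun this 1
      simp at e0 e1
      exact ⟨e1, e0⟩
    have := congrFun (hind 1 fun i => by simp [Fin.sum_univ_two, h0 i]) 0
    simp at this
  have hDR : (r 0 i * r 1 j - r 0 j * r 1 i : ℝ) ≠ 0 := by exact_mod_cast hD
  set D : ℝ := r 0 i * r 1 j - r 0 j * r 1 i
  refine ⟨Pi.single i ((x 0 * r 1 j - x 1 * r 0 j) / D) +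
    Pi.single j ((x 1 * r 0 i - x 0 * r 1 i) / D), fun k => ?_⟩
  simp only [Pi.add_apply, add_mul, Finset.sum_add_distrib, Pi.single_apply, ite_mul, zero_mul,
    Finset.sum_ite_eq', Finset.mem_univ, if_true]
  rw [div_mul_eq_mul_div, div_mul_eq_mul_div, ← add_div, div_eq_iff hDR]
  fin_cases k <;> simp only [D, Fin.zero_eta, Fin.mk_one] <;> ring

theorem stmt19 (v : Fin 3 → ℤ) (hpos : ∀ i, 0 < v i)
    (hinj : Function.Injective v)
    (hgcd : Finset.univ.gcd v = 1)
    (hsum : 10 ≤ v 0 + v 1 + v 2)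
    (r : Fin 2 → Fin 3 → ℤ)
    -- the rows `r k` lie in the lattice `ℤ³ ∩ v^⊥` ...
    (horth : ∀ k, ∑ i, r k i * v i = 0)
    -- ... and form a ℤ-basis of it
    (hbasis : ∀ w : Fin 3 → ℤ, (∑ i, w i * v i = 0) →
      ∃! c : Fin 2 → ℤ, w = fun i => ∑ k, c k * r k i)
    -- the zonotope generated by the columns of the matrix with rows `r k`
    (Z : Set (Fin 2 → ℝ))
    (hZ : Z = {x : Fin 2 → ℝ | ∃ t : Fin 3 → ℝ,
      (∀ j, t j ∈ Set.Icc (0 : ℝ) 1) ∧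
      x = ∑ j, t j • fun k => (r k j : ℝ)}) :
    covRad Z < 1 / 2 := by
  obtain ⟨μ, hμ0, hμ, hcov⟩ :=
    exists_uniform_box v (exists_time_in_open_box v hpos hinj hgcd hsum)
  refine lt_of_le_of_lt (csInf_le ⟨0, fun _ h => h.1⟩ ⟨hμ0.le, fun x => ?_⟩) hμ
  have hind : ∀ c : Fin 2 → ℤ, (∀ i, ∑ k, c k * r k i = 0) → c = 0 := by
    intro c hc
    refine (hbasis 0 (by simp)).unique (funext fun i => (hc i).symm) (funext fun i => ?_)
    simp
  obtain ⟨s, hs⟩ := exists_real_preimage r hind x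
  obtain ⟨t, w, h⟩ := hcov s
  refine ⟨fun k => ∑ j, w j * r k j, ?_⟩
  rw [hZ, Set.mem_smul_set]
  refine ⟨_, ⟨fun j => (s j + t * v j - w j) / μ, fun j => ⟨?_, ?_⟩, rfl⟩, ?_⟩
  · exact div_nonneg (h j).1 hμ0.le
  · exact (div_le_one hμ0).2 (h j).2
  · funext k
    have ho : ∑ i, (r k i : ℝ) * v i = 0 := by exact_mod_cast horth k
    simp only [Pi.smul_apply, Pi.sub_apply, Finset.sum_apply, smul_eq_mul, ← hs k]
    push_cast
    rw [Finset.mul_sum, ← Finset.sum_sub_distrib, ← add_zero (∑ j, (_ - _)), ← mul_zero t, ← ho,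
      Finset.mul_sum, ← Finset.sum_add_distrib]
    refine Finset.sum_congr rfl fun j _ => ?_
    field_simp
    ring
end
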